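/- arXiv:1108.2200 — 8 statements merged into one kernel-verified Lean document; each statement's English description precedes it below -/
import Mathlib

section
/- With the data above, for every s ∈ ℂ satisfying Re(s) > −Re(λ_j) for all 1 ≤ j ≤ k, the function a ↦ φ(a)·∏_{j=1}^{k} (sgn a_j)^{m_j}·|a_j|^{s+λ_j−1}·(log|a_j|)^{n_j} is (Bochner) integrable on ℝ^k with respect to Lebesgue measure; in particular the generalized Mellin transform F_φ(s) is well defined on this half-plane. -/
open MeasureTheory

/-- The integrand of the generalized Mellin transform on ℝ^k:
a ↦ φ(a)·∏_{j} (sgn a_j)^{m_j}·|a_j|^{s+λ_j−1}·(log|a_j|)^{n_j},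
taken to be 0 on the measure-zero set where some a_j = 0. Here |t|^w denotes
the complex power of the positive real |t|. -/
noncomputable def mellinIntegrand (k : ℕ) (lam : Fin k → ℂ) (m n : Fin k → ℕ)
    (φ : SchwartzMap (Fin k → ℝ) ℂ) (s : ℂ) (a : Fin k → ℝ) : ℂ :=
  if ∀ j, a j ≠ 0 then
    φ a * ∏ j, ((Real.sign (a j) : ℝ) : ℂ) ^ (m j) *
      ((|a j| : ℝ) : ℂ) ^ (s + lam j - 1) * ((Real.log |a j| : ℝ) : ℂ) ^ (n j)
  else 0

lemma mellinAux_abs (f : ℝ → ℝ) (hf : IntegrableOn f (Set.Ioi 0)) :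
    Integrable (fun t : ℝ => f |t|) := by
  have h1 : IntegrableOn (fun t : ℝ => f |t|) (Set.Ioi 0) :=
    hf.congr_fun (fun t ht => by simp [abs_of_pos (Set.mem_Ioi.1 ht)]) measurableSet_Ioi
  have h2 : IntegrableOn (fun t : ℝ => f |t|) (Set.Iio 0) := by
    have h := h1.comp_neg
    simpa using h
  rw [← integrableOn_univ, ← Set.Iic_union_Ioi (a := (0 : ℝ))]
  exact ((integrableOn_Iic_iff_integrableOn_Iio (by simp)).2 h2).union h1

lemma mellinAux_log_bound (δ : ℝ) (hδ : 0 < δ) (n : ℕ) (t : ℝ) (ht : 0 < t) :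
    |Real.log t| ^ n ≤ (n.factorial / δ ^ n) * (t ^ δ + t ^ (-δ)) := by
  have h1 := Real.pow_div_factorial_le_exp (δ * |Real.log t|) (by positivity) n
  have h2 : Real.exp (δ * |Real.log t|) ≤ t ^ δ + t ^ (-δ) := by
    rw [Real.rpow_def_of_pos ht, Real.rpow_def_of_pos ht]
    rcases abs_cases (Real.log t) with h | h
    · rw [h.1, mul_comm δ]
      linarith [Real.exp_pos (Real.log t * -δ)]
    · rw [h.1, show δ * -Real.log t = Real.log t * -δ by ring]
      linarith [Real.exp_pos (Real.log t * δ)]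
  have h3 := h1.trans h2
  rw [div_le_iff₀ (by positivity), mul_pow] at h3
  rw [div_mul_eq_mul_div, le_div_iff₀ (by positivity)]
  linarith

lemma mellinAux_pow (p : ℝ) (hp : 0 < p) (N : ℕ) (hN : p + 1 ≤ N) :
    IntegrableOn (fun t : ℝ => t ^ (p - 1) * ((1 + t) ^ N)⁻¹) (Set.Ioi 0) := by
  rw [← Set.Ioc_union_Ioi_eq_Ioi (zero_le_one (α := ℝ))]
  apply IntegrableOn.union
  · have h : IntegrableOn (fun t : ℝ => t ^ (p - 1)) (Set.Ioc 0 1) :=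
      (intervalIntegrable_iff_integrableOn_Ioc_of_le zero_le_one).1
        (intervalIntegral.intervalIntegrable_rpow' (by linarith))
    refine Integrable.mono' h (by fun_prop) ?_
    filter_upwards [ae_restrict_mem measurableSet_Ioc] with t ht
    have h0 : 0 < t := ht.1
    rw [Real.norm_of_nonneg (by positivity)]
    exact mul_le_of_le_one_right (by positivity)
      (inv_le_one_of_one_le₀ (one_le_pow₀ (by linarith)))
  · have h := integrableOn_Ioi_rpow_of_lt (a := -2) (c := 1) (by norm_num) one_pos
    refine Integrable.mono' h (by fun_prop) ?_
    filter_upwards [ae_restrict_mem measurableSet_Ioi] with t ht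
    have h1 : 1 < t := ht
    have h0 : 0 < t := by linarith
    rw [Real.norm_of_nonneg (by positivity)]
    calc t ^ (p - 1) * ((1 + t) ^ N)⁻¹ ≤ t ^ (p - 1) * (t ^ N)⁻¹ := by
          gcongr; linarith
      _ = t ^ (p - 1 - N) := by
          rw [Real.rpow_sub h0 (p - 1), Real.rpow_natCast, div_eq_mul_inv]
      _ ≤ t ^ (-2 : ℝ) := Real.rpow_le_rpow_of_exponent_le h1.le (by linarith)

lemma mellinAux_one (σ : ℝ) (hσ : 0 < σ) (n N : ℕ) (hN : 2 * σ + 1 ≤ N) :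
    Integrable (fun t : ℝ =>
      |t| ^ (σ - 1) * |(Real.log |t|)| ^ n * ((1 + |t|) ^ N)⁻¹) := by
  refine mellinAux_abs
    (fun t : ℝ => t ^ (σ - 1) * |Real.log t| ^ n * ((1 + t) ^ N)⁻¹) ?_
  have hA := (mellinAux_pow (σ + σ / 2) (by linarith) N (by linarith)).add
    (mellinAux_pow (σ - σ / 2) (by linarith) N (by linarith))
  refine Integrable.mono' (hA.const_mul (n.factorial / (σ / 2) ^ n)) (by fun_prop) ?_
  filter_upwards [ae_restrict_mem measurableSet_Ioi] with t ht
  have h0 : 0 < t := ht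
  rw [Real.norm_of_nonneg (by positivity)]
  calc t ^ (σ - 1) * |Real.log t| ^ n * ((1 + t) ^ N)⁻¹
      ≤ t ^ (σ - 1) * ((n.factorial / (σ / 2) ^ n) * (t ^ (σ / 2) + t ^ (-(σ / 2))))
          * ((1 + t) ^ N)⁻¹ := by
        gcongr
        exact mellinAux_log_bound _ (by linarith) n t h0
    _ = _ := by
        simp only [Pi.add_apply]
        rw [show σ + σ / 2 - 1 = (σ - 1) + σ / 2 by ring,
          show σ - σ / 2 - 1 = (σ - 1) + -(σ / 2) by ring,
          Real.rpow_add h0, Real.rpow_add h0]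
        ring

lemma mellinAux_measurable (k : ℕ) (lam : Fin k → ℂ) (m n : Fin k → ℕ)
    (φ : SchwartzMap (Fin k → ℝ) ℂ) (s : ℂ) :
    Measurable (mellinIntegrand k lam m n φ s) := by
  have hsgn : Measurable Real.sign := by
    unfold Real.sign
    exact Measurable.ite measurableSet_Iio measurable_const
      (Measurable.ite measurableSet_Ioi measurable_const measurable_const)
  have hφ : Measurable φ := φ.continuous.measurable
  unfold mellinIntegrand
  refine Measurable.ite ?_ ?_ measurable_const
  · rw [Set.ofPred_forall]
    refine MeasurableSet.iInter fun j => ?_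
    exact (measurableSet_eq_fun (measurable_pi_apply j) measurable_const).compl
  · fun_prop

/-- for every s ∈ ℂ with Re(s) > −Re(λ_j) for all j, the integrand of
the generalized Mellin transform F_φ(s) is Bochner integrable on ℝ^k with respect
to Lebesgue measure; in particular F_φ(s) is well defined on this half-plane. -/
theorem mellinIntegrand_integrable (k : ℕ) (hk : 1 ≤ k) (lam : Fin k → ℂ)
    (m n : Fin k → ℕ) (φ : SchwartzMap (Fin k → ℝ) ℂ) (s : ℂ)
    (hs : ∀ j, -(lam j).re < s.re) :
    Integrable (mellinIntegrand k lam m n φ s) (volume : Measure (Fin k → ℝ)) := by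
  obtain ⟨N, hN⟩ : ∃ N : ℕ, ∀ j, 2 * (s.re + (lam j).re) + 1 ≤ N := by
    choose f hf using fun j => exists_nat_ge (2 * (s.re + (lam j).re) + 1)
    refine ⟨∑ j, f j, fun j => (hf j).trans ?_⟩
    exact_mod_cast Finset.single_le_sum (f := f) (fun _ _ => Nat.zero_le _) (Finset.mem_univ j)
  obtain ⟨C, hC⟩ : ∃ C : ℝ, ∀ a, (1 + ‖a‖) ^ (N * k) * ‖φ a‖ ≤ C :=
    ⟨_, fun a => by
      simpa using SchwartzMap.one_add_le_sup_seminorm_apply (𝕜 := ℂ) (m := (N * k, 0))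
        (k := N * k) (n := 0) le_rfl le_rfl φ a⟩
  have hC0 : 0 ≤ C := le_trans (by positivity) (hC 0)
  have hI : Integrable (fun a : Fin k → ℝ => ∏ j, (|a j| ^ (s.re + (lam j).re - 1) *
      |(Real.log |a j|)| ^ (n j) * ((1 + |a j|) ^ N)⁻¹)) :=
    Integrable.fintype_prod (f := fun j t => |t| ^ (s.re + (lam j).re - 1) *
      |(Real.log |t|)| ^ (n j) * ((1 + |t|) ^ N)⁻¹)
      (fun j => mellinAux_one _ (by linarith [hs j]) (n j) N (hN j))
  refine Integrable.mono' (hI.const_mul C) (mellinAux_measurable ..).aestronglyMeasurable ?_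
  refine Filter.Eventually.of_forall fun a => ?_
  unfold mellinIntegrand
  split_ifs with ha
  · have hφ : ‖φ a‖ ≤ C * ∏ j, ((1 + |a j|) ^ N)⁻¹ := by
      have h1 : ∏ j, (1 + |a j|) ^ N ≤ (1 + ‖a‖) ^ (N * k) := by
        calc ∏ j, (1 + |a j|) ^ N ≤ ∏ _j : Fin k, (1 + ‖a‖) ^ N := by
              gcongr with j
              exact norm_le_pi_norm a j
          _ = _ := by simp [pow_mul]
      rw [Finset.prod_inv_distrib, ← div_eq_mul_inv,
        le_div_iff₀ (Finset.prod_pos fun j _ => by positivity), mul_comm]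
      exact le_trans (by gcongr) (hC a)
    rw [norm_mul, norm_prod, Finset.prod_mul_distrib (g := fun j => ((1 + |a j|) ^ N)⁻¹)]
    have h2 : ∏ j, ‖((Real.sign (a j) : ℝ) : ℂ) ^ (m j) *
        ((|a j| : ℝ) : ℂ) ^ (s + lam j - 1) * ((Real.log |a j| : ℝ) : ℂ) ^ (n j)‖
        ≤ ∏ j, |a j| ^ (s.re + (lam j).re - 1) * |(Real.log |a j|)| ^ (n j) := by
      refine Finset.prod_le_prod (fun _ _ => norm_nonneg _) fun j _ => ?_
      rw [norm_mul, norm_mul, norm_pow, norm_pow, Complex.norm_real, Complex.norm_real,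
        Complex.norm_cpow_eq_rpow_re_of_pos (abs_pos.2 (ha j))]
      have h3 : ‖Real.sign (a j)‖ = 1 := by
        rcases Real.sign_apply_eq_of_ne_zero _ (ha j) with h | h <;> simp [h]
      simp [h3]
    calc _ ≤ (C * ∏ j, ((1 + |a j|) ^ N)⁻¹) *
          ∏ j, |a j| ^ (s.re + (lam j).re - 1) * |(Real.log |a j|)| ^ (n j) :=
          mul_le_mul hφ h2 (Finset.prod_nonneg fun _ _ => norm_nonneg _)
            ((norm_nonneg _).trans hφ)
      _ = _ := by ring
  · rw [norm_zero]
    exact mul_nonneg hC0 (Finset.prod_nonneg fun _ _ => by positivity)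
end

section
/- With the data above: (i) for every s ∈ ℂ with Re(s) > −Re(λ_j) for all 1 ≤ j ≤ k, the integrand defining F_φ(s) is (Bochner) integrable on ℂ^k; and (ii) for every real M > 0 there exists a nonzero polynomial Q ∈ ℂ[X], depending only on M, k and the data (λ_j, m_j, n_j) and not on φ, such that for every Schwartz function φ ∈ 𝓢(ℂ^k, ℂ) there exists a function H : ℂ → ℂ holomorphic on {s : Re(s) > −M} with Q(s)·F_φ(s) = H(s) for every s satisfying Re(s) > −M and Re(s) > −Re(λ_j) for all j; hence F_φ extends meromorphically to all of ℂ. -/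
open MeasureTheory

/-- The integrand of the generalized Mellin transform on ℂ^k (ℂ^k viewed as a real
normed vector space): a ↦ φ(a)·∏_{j} (a_j/‖a_j‖)^{m_j}·‖a_j‖^{2(s+λ_j)−2}·(log‖a_j‖)^{n_j},
taken to be 0 on the measure-zero set where some a_j = 0. Here ‖·‖ is the complex
modulus and ‖t‖^w the complex power of the positive real ‖t‖. -/
noncomputable def mellinIntegrandC (k : ℕ) (lam : Fin k → ℂ) (m n : Fin k → ℕ)
    (φ : SchwartzMap (Fin k → ℂ) ℂ) (s : ℂ) (a : Fin k → ℂ) : ℂ :=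
  if ∀ j, a j ≠ 0 then
    φ a * ∏ j, (a j / (‖a j‖ : ℂ)) ^ (m j) *
      ((‖a j‖ : ℝ) : ℂ) ^ (2 * (s + lam j) - 2) * ((Real.log ‖a j‖ : ℝ) : ℂ) ^ (n j)
  else 0


lemma aux_int_pow (N : ℕ) (p : ℝ) (hp : -1 < p) (hN : p + 1 < N) :
    IntegrableOn (fun y : ℝ => ((1 + y) ^ N)⁻¹ * y ^ p) (Set.Ioi 0) := by
  have hm : Measurable (fun y : ℝ => ((1 + y) ^ N)⁻¹ * y ^ p) := by fun_prop
  rw [← Set.Ioc_union_Ioi_eq_Ioi (zero_le_one (α := ℝ))]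
  refine IntegrableOn.union ?_ ?_
  · have h := (intervalIntegral.intervalIntegrable_rpow' (a := 0) (b := 1) hp).1
    refine Integrable.mono' h hm.aestronglyMeasurable ?_
    filter_upwards [ae_restrict_mem measurableSet_Ioc] with y hy
    have hy0 : 0 < y := hy.1
    rw [Real.norm_of_nonneg (by positivity)]
    have : ((1 + y) ^ N)⁻¹ ≤ 1 := inv_le_one_of_one_le₀ (one_le_pow₀ (by linarith))
    have h2 : 0 ≤ y ^ p := by positivity
    nlinarith
  · have h := integrableOn_Ioi_rpow_of_lt (a := p - N) (c := 1) (by linarith) one_pos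
    refine Integrable.mono' h hm.aestronglyMeasurable ?_
    filter_upwards [ae_restrict_mem measurableSet_Ioi] with y hy
    have hy0 : 0 < y := lt_trans one_pos hy
    rw [Real.norm_of_nonneg (by positivity), Real.rpow_sub hy0, Real.rpow_natCast, div_eq_inv_mul]
    gcongr
    linarith

lemma aux_log_pow (n : ℕ) (e : ℝ) (he : 0 < e) (x : ℝ) :
    |x| ^ n ≤ (n.factorial / e ^ n) * (Real.exp (e * x) + Real.exp (-e * x)) := by
  have h := Real.pow_div_factorial_le_exp (x := e * |x|) (by positivity) n
  have h1 : Real.exp (e * |x|) ≤ Real.exp (e * x) + Real.exp (-e * x) := by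
    rcases abs_cases x with ⟨h, _⟩ | ⟨h, _⟩ <;> rw [h]
    · have := Real.exp_pos (-e * x); linarith
    · have := Real.exp_pos (e * x)
      rw [show e * -x = -e * x by ring]; linarith
  have h2 := h.trans h1
  rw [mul_pow, div_le_iff₀ (by positivity)] at h2
  rw [div_mul_eq_mul_div, le_div_iff₀ (by positivity)]
  linarith

noncomputable def radF (N : ℕ) (c : ℝ) (n : ℕ) (r : ℝ) : ℝ :=
  ((1 + r) ^ N)⁻¹ * (Real.exp (c * Real.log r) * |Real.log r| ^ n)

lemma radF_meas (N : ℕ) (c : ℝ) (n : ℕ) : Measurable (radF N c n) := by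
  unfold radF
  have : Measurable (fun r : ℝ => |Real.log r|) := Real.measurable_log.abs
  fun_prop

lemma radF_integrable (N : ℕ) (c : ℝ) (n : ℕ) (hc : -2 < c) (hN : 2 * c + 5 ≤ N) :
    Integrable (fun z : ℂ => radF N c n ‖z‖) := by
  rw [integrable_fun_norm_addHaar (volume : Measure ℂ) (f := radF N c n)]
  rw [Complex.finrank_real_complex]
  set e := (c + 2) / 2 with he
  have he0 : 0 < e := by rw [he]; linarith
  have h1 := aux_int_pow N (c + 1 + e) (by linarith) (by linarith)
  have h2 := aux_int_pow N (c + 1 - e) (by linarith) (by linarith)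
  have h3 := (h1.add h2).const_mul (n.factorial / e ^ n)
  refine Integrable.mono' h3 ?_ ?_
  · have := radF_meas N c n
    exact (by fun_prop : Measurable fun y : ℝ => y ^ (2-1) • radF N c n y).aestronglyMeasurable
  filter_upwards [ae_restrict_mem measurableSet_Ioi] with y hy
  have hy0 : 0 < y := hy
  have hr : 0 ≤ radF N c n y := by unfold radF; positivity
  rw [Real.norm_of_nonneg (by simp only [smul_eq_mul]; positivity)]
  have h4 := aux_log_pow n e he0 (Real.log y)
  have e1 : y ^ (c + 1 + e) = y * Real.exp (c * Real.log y) * Real.exp (e * Real.log y) := by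
    rw [Real.rpow_def_of_pos hy0]
    nth_rw 2 [← Real.exp_log hy0]
    rw [← Real.exp_add, ← Real.exp_add]; ring_nf
  have e2 : y ^ (c + 1 - e) = y * Real.exp (c * Real.log y) * Real.exp (-e * Real.log y) := by
    rw [Real.rpow_def_of_pos hy0]
    nth_rw 2 [← Real.exp_log hy0]
    rw [← Real.exp_add, ← Real.exp_add]; ring_nf
  simp only [Pi.add_apply, smul_eq_mul, radF, e1, e2]
  calc _ = (((1 + y) ^ N)⁻¹ * (y * Real.exp (c * Real.log y))) * |Real.log y| ^ n := by ring
    _ ≤ (((1 + y) ^ N)⁻¹ * (y * Real.exp (c * Real.log y))) * _ :=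
        mul_le_mul_of_nonneg_left h4 (by positivity)
    _ = _ := by ring

noncomputable def wt (c : ℂ) (n : ℕ) (z : ℂ) : ℂ :=
  Complex.exp (c * (Real.log ‖z‖ : ℝ)) * ((Real.log ‖z‖ : ℝ) : ℂ) ^ n

lemma wt_meas (c : ℂ) (n : ℕ) : Measurable (wt c n) := by
  unfold wt
  have : Measurable (fun z : ℂ => ((Real.log ‖z‖ : ℝ) : ℂ)) :=
    Complex.measurable_ofReal.comp (Real.measurable_log.comp measurable_norm)
  fun_prop

lemma wt_norm (c : ℂ) (n : ℕ) (z : ℂ) :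
    ‖wt c n z‖ = Real.exp (c.re * Real.log ‖z‖) * |Real.log ‖z‖| ^ n := by
  simp [wt, Complex.norm_exp]

section
variable {k : ℕ}

lemma schwartz_bound (φ : SchwartzMap (Fin k → ℂ) ℂ) (N : ℕ) :
    ∃ C : ℝ, 0 ≤ C ∧ ∀ a, ‖φ a‖ ≤ C * ∏ j, ((1 + ‖a j‖) ^ N)⁻¹ := by
  have h := SchwartzMap.one_add_le_sup_seminorm_apply (𝕜 := ℝ) (m := (N * k, 0)) (k := N * k)
    (n := 0) le_rfl le_rfl φ
  refine ⟨2 ^ (N * k) * ((Finset.Iic (N * k, 0)).sup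
      (fun m => SchwartzMap.seminorm ℝ (E := Fin k → ℂ) (F := ℂ) m.1 m.2)) φ, ?_, fun a => ?_⟩
  · positivity
  · have h1 := h a
    rw [norm_iteratedFDeriv_zero] at h1
    have h2 : ∏ j, (1 + ‖a j‖) ^ N ≤ (1 + ‖a‖) ^ (N * k) := by
      calc ∏ j, (1 + ‖a j‖) ^ N ≤ ∏ j : Fin k, (1 + ‖a‖) ^ N := by
            apply Finset.prod_le_prod
            · intros; positivity
            · intro i _
              gcongr
              exact norm_le_pi_norm a i
        _ = _ := by simp [pow_mul]
    rw [Finset.prod_inv_distrib, ← div_eq_mul_inv, le_div_iff₀ (by positivity)]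
    calc _ ≤ ‖φ a‖ * (1 + ‖a‖) ^ (N * k) := by gcongr
      _ ≤ _ := by rw [mul_comm]; exact h1

noncomputable def WW (c : Fin k → ℂ) (n : Fin k → ℕ) (a : Fin k → ℂ) : ℂ := ∏ j, wt (c j) (n j) (a j)

lemma WW_meas (c : Fin k → ℂ) (n : Fin k → ℕ) : Measurable (WW c n) := by
  unfold WW
  exact Finset.measurable_prod _ fun j _ => (wt_meas _ _).comp (measurable_pi_apply j)

noncomputable def domF (N : ℕ) (c : Fin k → ℂ) (n : Fin k → ℕ) (a : Fin k → ℂ) : ℝ :=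
  ∏ j, radF N (c j).re (n j) ‖a j‖

lemma domF_eq (N : ℕ) (c : Fin k → ℂ) (n : Fin k → ℕ) (a : Fin k → ℂ) :
    domF N c n a = (∏ j, ((1 + ‖a j‖) ^ N)⁻¹) * ‖WW c n a‖ := by
  simp only [domF, WW, norm_prod, wt_norm, radF, Finset.prod_mul_distrib]

lemma exists_N (c : Fin k → ℂ) : ∃ N : ℕ, ∀ j, 2 * (c j).re + 5 ≤ N := by
  choose f hf using fun j => exists_nat_ge (2 * (c j).re + 5)
  refine ⟨∑ j, f j, fun j => (hf j).trans ?_⟩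
  exact_mod_cast Finset.single_le_sum (fun i _ => Nat.zero_le (f i)) (Finset.mem_univ j)

lemma domF_integrable (N : ℕ) (c : Fin k → ℂ) (n : Fin k → ℕ) (hc : ∀ j, -2 < (c j).re)
    (hN : ∀ j, 2 * (c j).re + 5 ≤ N) : Integrable (domF N c n) := by
  unfold domF
  exact Integrable.fintype_prod (f := fun j (z : ℂ) => radF N (c j).re (n j) ‖z‖)
    (fun j => radF_integrable N _ _ (hc j) (hN j))

structure Ang (k : ℕ) where
  f : (Fin k → ℂ) → ℂ
  meas : Measurable f
  bd : ∀ a, ‖f a‖ ≤ 1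
  inv : ∀ (j : Fin k) (L : ℝ) a, f (fun i => (if i = j then (Real.exp L : ℂ) else 1) * a i) = f a

lemma int_main (Θ : Ang k) (φ : SchwartzMap (Fin k → ℂ) ℂ) (c : Fin k → ℂ) (n : Fin k → ℕ)
    (hc : ∀ j, -2 < (c j).re) : Integrable (fun a => φ a * Θ.f a * WW c n a) := by
  obtain ⟨N, hN⟩ := exists_N c
  obtain ⟨C, hC, hb⟩ := schwartz_bound φ N
  refine Integrable.mono' ((domF_integrable N c n hc hN).const_mul C) ?_ ?_
  · have := φ.continuous.measurable
    have := Θ.meas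
    have := WW_meas c n
    exact (by fun_prop : Measurable fun a => φ a * Θ.f a * WW c n a).aestronglyMeasurable
  · refine Filter.Eventually.of_forall fun a => ?_
    rw [domF_eq, norm_mul, norm_mul]
    have h1 := hb a
    have h2 := Θ.bd a
    calc _ ≤ ‖φ a‖ * 1 * ‖WW c n a‖ := by gcongr
      _ ≤ (C * ∏ j, ((1 + ‖a j‖) ^ N)⁻¹) * 1 * ‖WW c n a‖ := by gcongr
      _ = _ := by ring

/-- holomorphy -/
lemma holo_gen {α : Type*} [MeasurableSpace α] (ν : Measure α) (f : α → ℂ) (l : α → ℝ)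
    (hf : Measurable f) (hl : Measurable l) (b : ℝ)
    (hi : ∀ s : ℂ, b < s.re → Integrable (fun a => f a * Complex.exp (s * l a)) ν) :
    DifferentiableOn ℂ (fun s => ∫ a, f a * Complex.exp (s * l a) ∂ν) {s | b < s.re} := by
  intro s hs
  have hs' : b < s.re := hs
  set d := (s.re - b) / 3 with hd
  have hd0 : 0 < d := by rw [hd]; linarith
  have key := hasDerivAt_integral_of_dominated_loc_of_deriv_le (𝕜 := ℂ) (μ := ν) (x₀ := s)
    (s := Metric.ball s d) (F := fun s a => f a * Complex.exp (s * l a))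
    (F' := fun s a => f a * (Complex.exp (s * l a) * l a))
    (bound := fun a => (1 / d) * (‖f a * Complex.exp (((s.re + 2 * d : ℝ) : ℂ) * l a)‖ + 
      2 * ‖f a * Complex.exp ((s.re : ℂ) * l a)‖ +
      ‖f a * Complex.exp (((s.re - 2 * d : ℝ) : ℂ) * l a)‖))
    (Metric.ball_mem_nhds s hd0) ?_ (hi s hs') ?_ ?_ ?_ ?_
  · exact key.2.differentiableAt.differentiableWithinAt
  · refine Filter.Eventually.of_forall fun z => ?_
    exact (by fun_prop : Measurable fun a => f a * Complex.exp (z * l a)).aestronglyMeasurable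
  · exact (by fun_prop : Measurable fun a => f a * (Complex.exp (s * l a) * l a)).aestronglyMeasurable
  · refine Filter.Eventually.of_forall fun a z hz => ?_
    simp only [norm_mul, Complex.norm_exp, Complex.re_mul_ofReal,
      Complex.ofReal_re, Complex.norm_real, Real.norm_eq_abs]
    have hz1 : |z.re - s.re| ≤ d := by
      have := (Complex.abs_re_le_norm (z - s)).trans (by simpa [dist_eq_norm] using (Metric.mem_ball.1 hz).le)
      simpa using this
    have h4 := aux_log_pow 1 d hd0 (l a)
    simp only [pow_one, Nat.factorial_one, Nat.cast_one] at h4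
    have h5 : Real.exp (z.re * l a) ≤ Real.exp (s.re * l a) * (Real.exp (d * l a) + Real.exp (-d * l a)) := by
      have h6 : Real.exp ((z.re - s.re) * l a) ≤ Real.exp (d * l a) + Real.exp (-d * l a) := by
        have hx : (z.re - s.re) * l a ≤ d * |l a| := by
          calc _ ≤ |(z.re - s.re) * l a| := le_abs_self _
            _ = |z.re - s.re| * |l a| := abs_mul _ _
            _ ≤ _ := by gcongr
        refine (Real.exp_le_exp.2 hx).trans ?_
        rcases abs_cases (l a) with ⟨h, _⟩ | ⟨h, _⟩ <;> rw [h]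
        · have := Real.exp_pos (-d * l a); linarith
        · have := Real.exp_pos (d * l a)
          rw [show d * -l a = -d * l a by ring]; linarith
      calc _ = Real.exp (s.re * l a) * Real.exp ((z.re - s.re) * l a) := by
            rw [← Real.exp_add]; ring_nf
        _ ≤ _ := by gcongr
    have e1 : Real.exp ((s.re + 2 * d) * l a) = Real.exp (s.re * l a) * Real.exp (d * l a) * Real.exp (d * l a) := by
      rw [← Real.exp_add, ← Real.exp_add]; ring_nf
    have e2 : Real.exp ((s.re - 2 * d) * l a) = Real.exp (s.re * l a) * Real.exp (-d * l a) * Real.exp (-d * l a) := by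
      rw [← Real.exp_add, ← Real.exp_add]; ring_nf
    have e3 : Real.exp (d * l a) * Real.exp (-d * l a) = 1 := by
      rw [← Real.exp_add]; simp
    rw [e1, e2]
    calc _ ≤ ‖f a‖ * ((Real.exp (s.re * l a) * (Real.exp (d * l a) + Real.exp (-d * l a))) * 
          (1 / d * (Real.exp (d * l a) + Real.exp (-d * l a)))) := by gcongr
      _ = 1 / d * (‖f a‖ * (Real.exp (s.re * l a) * Real.exp (d * l a) * Real.exp (d * l a)) + 
         2 * (‖f a‖ * Real.exp (s.re * l a)) * (Real.exp (d * l a) * Real.exp (-d * l a)) +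
         ‖f a‖ * (Real.exp (s.re * l a) * Real.exp (-d * l a) * Real.exp (-d * l a))) := by ring
      _ = _ := by rw [e3]; ring
  · refine Integrable.const_mul ((Integrable.add (hi _ ?_).norm ((hi _ ?_).norm.const_mul 2)).add (hi _ ?_).norm) _
    all_goals simp only [Complex.ofReal_re]; linarith
  · refine Filter.Eventually.of_forall fun a z hz => ?_
    have := ((hasDerivAt_id z).mul_const (l a : ℂ)).cexp.const_mul (f a)
    simpa using this

noncomputable def scl (j : Fin k) (L : ℝ) (a : Fin k → ℂ) : Fin k → ℂ :=
  fun i => (if i = j then (Real.exp L : ℂ) else 1) * a i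

lemma scl_neg_scl (j : Fin k) (L : ℝ) (a : Fin k → ℂ) : scl j (-L) (scl j L a) = a := by
  funext i
  by_cases h : i = j
  · simp only [scl, h, if_true, ← mul_assoc, ← Complex.ofReal_mul, ← Real.exp_add]; simp
  · simp [scl, h]

lemma scl_zero (j : Fin k) (a : Fin k → ℂ) : scl j 0 a = a := by
  funext i
  by_cases h : i = j <;> simp [scl, h]

lemma scl_cont (j : Fin k) (L : ℝ) : Continuous (scl j L) := by
  unfold scl; fun_prop

lemma integral_scl (j : Fin k) (L : ℝ) (g : (Fin k → ℂ) → ℂ) :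
    ∫ a, g (scl j L a) = Complex.exp (-2 * L) * ∫ a, g a := by
  set f : (Fin k → ℂ) →ₗ[ℂ] (Fin k → ℂ) :=
    Matrix.toLin' (Matrix.diagonal fun i => if i = j then (Real.exp L : ℂ) else 1) with hf
  have hfs : ∀ a, f a = scl j L a := by
    intro a; funext i
    simp [hf, scl, Matrix.toLin'_apply, Matrix.mulVec_diagonal]
  have hdet : (f.restrictScalars ℝ).det = Real.exp L ^ 2 := by
    rw [LinearMap.det_restrictScalars, hf, LinearMap.det_toLin', Matrix.det_diagonal,
      Finset.prod_ite_eq' Finset.univ j]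
    simp only [Finset.mem_univ, if_true, Algebra.norm_complex_eq]
    simp [Complex.normSq_ofReal, sq, -Complex.ofReal_exp]
  have hm := Measure.map_linearMap_addHaar_eq_smul_addHaar (volume : Measure (Fin k → ℂ))
    (f := f.restrictScalars ℝ) (by rw [hdet]; positivity)
  have hfun : ⇑(f.restrictScalars ℝ) = scl j L := funext hfs
  rw [hfun, hdet] at hm
  have hemb : MeasurableEmbedding (scl j L) :=
    (scl_cont j L).measurableEmbedding (fun a b h => by
      rw [← scl_neg_scl j L a, h, scl_neg_scl])
  rw [← hemb.integral_map, hm, integral_smul_measure, ENNReal.toReal_ofReal (abs_nonneg _),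
    abs_of_pos (by positivity), ← Real.exp_nat_mul, ← Real.exp_neg, Complex.real_smul]
  push_cast; ring_nf

noncomputable def WR (j : Fin k) (c : Fin k → ℂ) (n : Fin k → ℕ) (a : Fin k → ℂ) : ℂ :=
  ∏ i ∈ Finset.univ.erase j, wt (c i) (n i) (a i)

lemma WW_factor (j : Fin k) (c : Fin k → ℂ) (n : Fin k → ℕ) (a : Fin k → ℂ) :
    WW c n a = wt (c j) (n j) (a j) * WR j c n a :=
  (Finset.mul_prod_erase _ _ (Finset.mem_univ j)).symm

lemma WR_congr (j : Fin k) {c c' : Fin k → ℂ} {n n' : Fin k → ℕ} {a a' : Fin k → ℂ}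
    (hc : ∀ i, i ≠ j → c i = c' i) (hn : ∀ i, i ≠ j → n i = n' i) (ha : ∀ i, i ≠ j → a i = a' i) :
    WR j c n a = WR j c' n' a' := by
  refine Finset.prod_congr rfl fun i hi => ?_
  have h := Finset.ne_of_mem_erase hi
  rw [hc i h, hn i h, ha i h]

lemma wt_scl (c : ℂ) (p : ℕ) (L : ℝ) (z : ℂ) (hz : z ≠ 0) :
    wt c p ((Real.exp L : ℂ) * z) = Complex.exp (c * L) *
      ∑ i ∈ Finset.range (p + 1), wt c i z * ((L : ℂ) ^ (p - i) * (p.choose i : ℂ)) := by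
  have hlog : Real.log ‖(Real.exp L : ℂ) * z‖ = Real.log ‖z‖ + L := by
    rw [norm_mul, Complex.norm_real, Real.norm_of_nonneg (Real.exp_pos L).le,
      Real.log_mul (Real.exp_pos L).ne' (norm_ne_zero_iff.2 hz), Real.log_exp, add_comm]
  unfold wt
  rw [hlog]
  push_cast
  rw [add_pow, mul_add, Complex.exp_add, Finset.mul_sum, Finset.mul_sum]
  refine Finset.sum_congr rfl fun i _ => ?_
  ring

lemma WW_scl (j : Fin k) (c : Fin k → ℂ) (n : Fin k → ℕ) (L : ℝ) (a : Fin k → ℂ) (ha : a j ≠ 0) :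
    WW c n (scl j L a) = Complex.exp (c j * L) * ∑ i ∈ Finset.range (n j + 1),
      WW c (Function.update n j i) a * ((L : ℂ) ^ (n j - i) * ((n j).choose i : ℂ)) := by
  rw [WW_factor j]
  have h1 : scl j L a j = (Real.exp L : ℂ) * a j := by simp [scl]
  rw [h1, wt_scl _ _ _ _ ha, mul_assoc, Finset.sum_mul]
  congr 1
  refine Finset.sum_congr rfl fun i _ => ?_
  rw [WW_factor j c (Function.update n j i) a, Function.update_self,
    WR_congr j (c := c) (c' := c) (n := n) (n' := Function.update n j i) (a := scl j L a) (a' := a)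
      (fun _ _ => rfl) (fun i h => by simp [h]) (fun i h => by simp [scl, h])]
  ring

lemma ae_ne (j : Fin k) : ∀ᵐ a : Fin k → ℂ, a j ≠ 0 :=
  Measure.ae_eval_ne (fun _ => (volume : Measure ℂ)) j 0

lemma scl_formula (Θ : Ang k) (φ : SchwartzMap (Fin k → ℂ) ℂ) (c : Fin k → ℂ) (n : Fin k → ℕ)
    (hc : ∀ j, -2 < (c j).re) (j : Fin k) (L : ℝ) :
    ∫ a, φ (scl j L a) * Θ.f a * WW c n a = Complex.exp (-(c j + 2) * L) *
      ∑ i ∈ Finset.range (n j + 1), (∫ a, φ a * Θ.f a * WW c (Function.update n j i) a) *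
        ((-(L : ℂ)) ^ (n j - i) * ((n j).choose i : ℂ)) := by
  have h1 := integral_scl j L (fun b => φ b * Θ.f b * WW c n (scl j (-L) b))
  have h2 : ∀ a, Θ.f (scl j L a) = Θ.f a := fun a => Θ.inv j L a
  simp only [scl_neg_scl, h2] at h1
  rw [h1]
  have h3 : ∫ b, φ b * Θ.f b * WW c n (scl j (-L) b) = ∫ b, Complex.exp (-(c j) * L) *
      ∑ i ∈ Finset.range (n j + 1), (φ b * Θ.f b * WW c (Function.update n j i) b) *
        ((-(L : ℂ)) ^ (n j - i) * ((n j).choose i : ℂ)) := by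
    refine integral_congr_ae ?_
    filter_upwards [ae_ne j] with b hb
    rw [WW_scl j c n (-L) b hb]
    push_cast
    rw [mul_neg, ← neg_mul, mul_left_comm, Finset.mul_sum]
    congr 1
    refine Finset.sum_congr rfl fun i _ => ?_
    ring
  rw [h3, integral_const_mul, integral_finsetSum]
  · rw [← mul_assoc, ← Complex.exp_add]
    congr 1
    · ring_nf
    · refine Finset.sum_congr rfl fun i _ => ?_
      rw [integral_mul_const]
  · intro i _
    exact (int_main Θ φ c _ hc).mul_const _

lemma deriv_aux (d : ℂ) (p : ℕ) (A : ℕ → ℂ) :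
    HasDerivAt (fun z : ℂ => Complex.exp (-d * z) *
      ∑ i ∈ Finset.range (p + 1), A i * ((-z) ^ (p - i) * (p.choose i : ℂ)))
      (-(d * A p) - p * A (p - 1)) 0 := by
  have h1 : HasDerivAt (fun z : ℂ => Complex.exp (-d * z)) (-d) 0 := by
    have := ((hasDerivAt_id (0 : ℂ)).const_mul (-d)).cexp
    simpa using this
  have h2 : HasDerivAt (fun z : ℂ => ∑ i ∈ Finset.range (p + 1),
      A i * ((-z) ^ (p - i) * (p.choose i : ℂ)))
      (∑ i ∈ Finset.range (p + 1), A i * ((((p - i : ℕ) : ℂ) * (-0) ^ (p - i - 1) * (-1)) * (p.choose i : ℂ))) 0 := by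
    refine HasDerivAt.fun_sum fun i _ => ?_
    exact ((((hasDerivAt_id (0 : ℂ)).neg).pow (p - i)).mul_const _).const_mul _
  have h3 := h1.mul h2
  refine h3.congr_deriv ?_
  have e1 : ∑ i ∈ Finset.range (p + 1), A i * ((-(0 : ℂ)) ^ (p - i) * (p.choose i : ℂ)) = A p := by
    rw [Finset.sum_range_succ, Finset.sum_eq_zero]
    · simp
    · intro i hi
      have : p - i ≠ 0 := by have := Finset.mem_range.1 hi; omega
      simp [this]
  have e2 : ∑ i ∈ Finset.range (p + 1), A i * ((((p - i : ℕ) : ℂ) * (-0) ^ (p - i - 1) * (-1)) * (p.choose i : ℂ)) = - (p * A (p - 1)) := by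
    cases p with
    | zero => simp
    | succ q =>
      rw [Finset.sum_range_succ, Finset.sum_range_succ, Finset.sum_eq_zero]
      · simp; ring
      · intro i hi
        have : q + 1 - i - 1 ≠ 0 := by have := Finset.mem_range.1 hi; omega
        simp [this]
  rw [e1, e2]
  simp; ring

open LineDeriv in
noncomputable def dX (j : Fin k) (φ : SchwartzMap (Fin k → ℂ) ℂ) : SchwartzMap (Fin k → ℂ) ℂ :=
  ∂_{(Pi.single j 1 : Fin k → ℂ)} φ

open LineDeriv in
noncomputable def dY (j : Fin k) (φ : SchwartzMap (Fin k → ℂ) ℂ) : SchwartzMap (Fin k → ℂ) ℂ :=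
  ∂_{(Pi.single j Complex.I : Fin k → ℂ)} φ

noncomputable def Eul (j : Fin k) (φ : SchwartzMap (Fin k → ℂ) ℂ) (a : Fin k → ℂ) : ℂ :=
  ((a j).re : ℂ) * dX j φ a + ((a j).im : ℂ) * dY j φ a

lemma hasDerivAt_scl (j : Fin k) (φ : SchwartzMap (Fin k → ℂ) ℂ) (a : Fin k → ℂ) (L : ℝ) :
    HasDerivAt (fun L : ℝ => φ (scl j L a)) (Eul j φ (scl j L a)) L := by
  have h1 : HasDerivAt (fun L : ℝ => scl j L a) (Pi.single j (scl j L a j)) L := by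
    rw [hasDerivAt_pi]
    intro i
    by_cases h : i = j
    · subst h
      simp only [scl, if_true, Pi.single_eq_same]
      exact ((Real.hasDerivAt_exp L).ofReal_comp).mul_const _
    · simp only [scl, h, if_false, Pi.single_eq_of_ne, ne_eq, not_false_eq_true]
      exact hasDerivAt_const _ _
  have h2 := (φ.differentiableAt (x := scl j L a)).hasFDerivAt.comp_hasDerivAt L h1
  refine h2.congr_deriv ?_
  have h3 : (Pi.single j (scl j L a j) : Fin k → ℂ) = (scl j L a j).re • (Pi.single j (1 : ℂ) : Fin k → ℂ)
      + (scl j L a j).im • (Pi.single j Complex.I : Fin k → ℂ) := by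
    rw [← Pi.single_smul, ← Pi.single_smul, ← Pi.single_add]
    congr 1
    simp only [Complex.real_smul, mul_one]
    exact (Complex.re_add_im _).symm
  rw [h3, map_add, map_smul, map_smul]
  simp only [Eul, dX, dY, SchwartzMap.lineDerivOp_apply_eq_fderiv, Complex.real_smul]

lemma Eul_bound (j : Fin k) (φ : SchwartzMap (Fin k → ℂ) ℂ) (N : ℕ) :
    ∃ C : ℝ, 0 ≤ C ∧ ∀ a, ‖Eul j φ a‖ ≤ C * ∏ i, ((1 + ‖a i‖) ^ N)⁻¹ := by
  obtain ⟨C1, h1, hb1⟩ := schwartz_bound (dX j φ) (N + 1)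
  obtain ⟨C2, h2, hb2⟩ := schwartz_bound (dY j φ) (N + 1)
  refine ⟨C1 + C2, by positivity, fun a => ?_⟩
  have hP : ‖a j‖ * ∏ i, ((1 + ‖a i‖) ^ (N + 1))⁻¹ ≤ ∏ i, ((1 + ‖a i‖) ^ N)⁻¹ := by
    have hle : ∏ i ∈ Finset.univ.erase j, ((1 + ‖a i‖) ^ (N + 1))⁻¹ ≤ 
        ∏ i ∈ Finset.univ.erase j, ((1 + ‖a i‖) ^ N)⁻¹ := by
      refine Finset.prod_le_prod (fun i _ => by positivity) fun i _ => ?_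
      gcongr
      · have := norm_nonneg (a i); linarith
      · omega
    rw [← Finset.mul_prod_erase _ _ (Finset.mem_univ j),
      ← Finset.mul_prod_erase Finset.univ (fun i => ((1 + ‖a i‖) ^ N)⁻¹) (Finset.mem_univ j), ← mul_assoc]
    refine mul_le_mul ?_ hle (by positivity) (by positivity)
    rw [← div_eq_mul_inv, div_le_iff₀ (by positivity), pow_succ, ← mul_assoc, inv_mul_cancel₀ (by positivity)]
    linarith
  calc ‖Eul j φ a‖ ≤ ‖a j‖ * ‖dX j φ a‖ + ‖a j‖ * ‖dY j φ a‖ := by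
        unfold Eul
        refine (norm_add_le _ _).trans ?_
        rw [norm_mul, norm_mul, Complex.norm_real, Complex.norm_real]
        gcongr
        · exact Complex.abs_re_le_norm _
        · exact Complex.abs_im_le_norm _
    _ ≤ ‖a j‖ * (C1 * ∏ i, ((1 + ‖a i‖) ^ (N + 1))⁻¹) + ‖a j‖ * (C2 * ∏ i, ((1 + ‖a i‖) ^ (N + 1))⁻¹) := by
        gcongr
        · exact hb1 a
        · exact hb2 a
    _ = (C1 + C2) * (‖a j‖ * ∏ i, ((1 + ‖a i‖) ^ (N + 1))⁻¹) := by ring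
    _ ≤ _ := by gcongr

lemma scl_prod_bound (j : Fin k) (N : ℕ) (L : ℝ) (hL : -1 ≤ L) (a : Fin k → ℂ) :
    ∏ i, ((1 + ‖scl j L a i‖) ^ N)⁻¹ ≤ Real.exp 1 ^ (N * k) * ∏ i, ((1 + ‖a i‖) ^ N)⁻¹ := by
  have : Real.exp 1 ^ (N * k) * ∏ i, ((1 + ‖a i‖) ^ N)⁻¹ =
      ∏ i, (Real.exp 1 ^ N * ((1 + ‖a i‖) ^ N)⁻¹) := by
    rw [Finset.prod_mul_distrib]; simp [pow_mul]
  rw [this]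
  refine Finset.prod_le_prod (fun i _ => by positivity) fun i _ => ?_
  rw [← div_eq_mul_inv, le_div_iff₀ (by positivity), inv_mul_le_iff₀ (by positivity), ← mul_pow]
  have he1 : 1 ≤ Real.exp 1 := Real.one_le_exp (by norm_num)
  gcongr
  by_cases h : i = j
  · have h2 : 1 ≤ Real.exp L * Real.exp 1 := by
      rw [← Real.exp_add]; exact Real.one_le_exp (by linarith)
    simp only [scl, h, if_true, norm_mul, Complex.norm_real, Real.norm_of_nonneg (Real.exp_pos L).le]
    nlinarith [norm_nonneg (a j)]
  · simp only [scl, h, if_false, one_mul]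
    nlinarith [norm_nonneg (a i)]

lemma Eul_meas (j : Fin k) (φ : SchwartzMap (Fin k → ℂ) ℂ) : Measurable (Eul j φ) := by
  have := (dX j φ).continuous
  have := (dY j φ).continuous
  refine Continuous.measurable ?_
  unfold Eul
  fun_prop

lemma deriv_scl (Θ : Ang k) (φ : SchwartzMap (Fin k → ℂ) ℂ) (c : Fin k → ℂ) (n : Fin k → ℕ)
    (hc : ∀ j, -2 < (c j).re) (j : Fin k) :
    HasDerivAt (fun L : ℝ => ∫ a, φ (scl j L a) * Θ.f a * WW c n a)
      (∫ a, Eul j φ a * Θ.f a * WW c n a) 0 := by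
  obtain ⟨N, hN⟩ := exists_N c
  obtain ⟨C, hC, hb⟩ := Eul_bound j φ N
  have m1 := φ.continuous.measurable
  have m2 := Θ.meas
  have m3 := WW_meas c n
  have m4 := Eul_meas j φ
  have key := hasDerivAt_integral_of_dominated_loc_of_deriv_le (𝕜 := ℝ) (μ := volume) (x₀ := (0 : ℝ))
    (s := Metric.ball 0 1) (F := fun L a => φ (scl j L a) * Θ.f a * WW c n a)
    (F' := fun L a => Eul j φ (scl j L a) * Θ.f a * WW c n a)
    (bound := fun a => (C * Real.exp 1 ^ (N * k)) * domF N c n a)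
    (Metric.ball_mem_nhds 0 one_pos) ?_ ?_ ?_ ?_ ?_ ?_
  · have := key.2
    simpa only [scl_zero] using this
  · refine Filter.Eventually.of_forall fun L => ?_
    have m5 := (scl_cont j L).measurable
    exact (by fun_prop : Measurable fun a => φ (scl j L a) * Θ.f a * WW c n a).aestronglyMeasurable
  · simpa only [scl_zero] using int_main Θ φ c n hc
  · have m5 := (scl_cont j 0).measurable
    exact (by fun_prop : Measurable fun a => Eul j φ (scl j 0 a) * Θ.f a * WW c n a).aestronglyMeasurable
  · refine Filter.Eventually.of_forall fun a L hL => ?_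
    have hL1 : -1 ≤ L := by
      have : |L| < 1 := by simpa using hL
      exact (abs_lt.1 this).1.le
    rw [domF_eq, norm_mul, norm_mul]
    calc _ ≤ (C * ∏ i, ((1 + ‖scl j L a i‖) ^ N)⁻¹) * 1 * ‖WW c n a‖ := by
          gcongr
          · exact hb _
          · exact Θ.bd a
      _ ≤ (C * (Real.exp 1 ^ (N * k) * ∏ i, ((1 + ‖a i‖) ^ N)⁻¹)) * 1 * ‖WW c n a‖ := by
          gcongr
          exact scl_prod_bound j N L hL1 a
      _ = _ := by ring
  · exact (domF_integrable N c n hc hN).const_mul _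
  · refine Filter.Eventually.of_forall fun a L _ => ?_
    exact ((hasDerivAt_scl j φ a L).mul_const _).mul_const _

lemma ibp (Θ : Ang k) (φ : SchwartzMap (Fin k → ℂ) ℂ) (c : Fin k → ℂ) (n : Fin k → ℕ)
    (hc : ∀ j, -2 < (c j).re) (j : Fin k) :
    (c j + 2) * (∫ a, φ a * Θ.f a * WW c n a) =
      - (∫ a, Eul j φ a * Θ.f a * WW c n a)
      - (n j : ℂ) * ∫ a, φ a * Θ.f a * WW c (Function.update n j (n j - 1)) a := by
  have h1 := deriv_scl Θ φ c n hc j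
  have h2 := deriv_aux (c j + 2) (n j)
    (fun i => ∫ a, φ a * Θ.f a * WW c (Function.update n j i) a)
  rw [← Complex.ofReal_zero] at h2
  have h3 := h2.comp_ofReal
  simp only [← scl_formula Θ φ c n hc j] at h3
  have h4 := h1.unique h3
  rw [Function.update_eq_self] at h4
  rw [h4]
  ring

/-- angular factor multiplied by a coordinate direction -/
noncomputable def Ang.mulDir (Θ : Ang k) (j : Fin k) (u : ℂ → ℝ) (hu : Measurable u)
    (hb : ∀ z, |u z| ≤ ‖z‖) (hs : ∀ (t : ℝ) z, u (t * z) = t * u z) : Ang k where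
  f a := Θ.f a * ((u (a j) / ‖a j‖ : ℝ) : ℂ)
  meas := by
    have := Θ.meas
    fun_prop
  bd a := by
    rw [norm_mul, Complex.norm_real, Real.norm_eq_abs, abs_div, abs_norm]
    exact mul_le_one₀ (Θ.bd a) (by positivity) (div_le_one_of_le₀ (hb _) (norm_nonneg _))
  inv i L a := by
    rw [Θ.inv]
    congr 2
    by_cases h : j = i
    · simp only [h, if_true, hs, norm_mul, Complex.norm_real, Real.norm_of_nonneg (Real.exp_pos L).le]
      exact mul_div_mul_left _ _ (Real.exp_pos L).ne'
    · simp [h]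

noncomputable def Ang.re (Θ : Ang k) (j : Fin k) : Ang k :=
  Θ.mulDir j Complex.re Complex.measurable_re Complex.abs_re_le_norm (by simp)

noncomputable def Ang.im (Θ : Ang k) (j : Fin k) : Ang k :=
  Θ.mulDir j Complex.im Complex.measurable_im Complex.abs_im_le_norm (by simp)

lemma WW_shift (j : Fin k) (c : Fin k → ℂ) (n : Fin k → ℕ) (a : Fin k → ℂ) (u : ℝ)
    (hu : |u| ≤ ‖a j‖) :
    ((u / ‖a j‖ : ℝ) : ℂ) * WW (Function.update c j (c j + 1)) n a = u * WW c n a := by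
  rw [WW_factor j, WW_factor j c, Function.update_self,
    WR_congr j (c := Function.update c j (c j + 1)) (c' := c) (n' := n) (a' := a) (fun i h => by simp [h])
      (fun _ _ => rfl) (fun _ _ => rfl), ← mul_assoc, ← mul_assoc]
  congr 1
  by_cases h : a j = 0
  · have : u = 0 := by simpa [h] using hu
    simp [this]
  · have hn : 0 < ‖a j‖ := norm_pos_iff.2 h
    unfold wt
    rw [add_mul, Complex.exp_add, one_mul, ← Complex.ofReal_exp, Real.exp_log hn]
    have : (‖a j‖ : ℂ) ≠ 0 := by exact_mod_cast hn.ne'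
    push_cast
    field_simp

lemma ibp2 (Θ : Ang k) (φ : SchwartzMap (Fin k → ℂ) ℂ) (c : Fin k → ℂ) (n : Fin k → ℕ)
    (hc : ∀ j, -2 < (c j).re) (j : Fin k) :
    (c j + 2) * (∫ a, φ a * Θ.f a * WW c n a) =
      - (∫ a, dX j φ a * (Θ.re j).f a * WW (Function.update c j (c j + 1)) n a)
      - (∫ a, dY j φ a * (Θ.im j).f a * WW (Function.update c j (c j + 1)) n a)
      - (n j : ℂ) * ∫ a, φ a * Θ.f a * WW c (Function.update n j (n j - 1)) a := by
  have hc' : ∀ i, -2 < (Function.update c j (c j + 1) i).re := by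
    intro i
    by_cases h : i = j
    · subst h; have := hc i; simp; linarith
    · simpa [h] using hc i
  rw [ibp Θ φ c n hc j]
  congr 1
  rw [← neg_add', ← integral_add (int_main _ _ _ _ hc') (int_main _ _ _ _ hc')]
  congr 2
  funext a
  have hx := WW_shift j c n a (a j).re (Complex.abs_re_le_norm _)
  have hy := WW_shift j c n a (a j).im (Complex.abs_im_le_norm _)
  simp only [Ang.re, Ang.im, Ang.mulDir, Eul]
  linear_combination (- dX j φ a * Θ.f a) * hx - (dY j φ a * Θ.f a) * hy

def GoodC (M : ℝ) (μ : Fin k → ℂ) (n : Fin k → ℕ) (Θ : Ang k) : Prop :=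
  ∃ Q : Polynomial ℂ, Q ≠ 0 ∧ ∀ φ : SchwartzMap (Fin k → ℂ) ℂ, ∃ H : ℂ → ℂ,
    DifferentiableOn ℂ H {s : ℂ | -M < s.re} ∧
    ∀ s : ℂ, -M < s.re → (∀ j, 0 < 2 * s.re + (μ j).re) →
      Q.eval s * (∫ a, φ a * Θ.f a * WW (fun j => 2 * s + μ j - 2) n a) = H s

lemma re_aux (s μ : ℂ) (h : 0 < 2 * s.re + μ.re) : -2 < (2 * s + μ - 2).re := by
  simp; linarith

lemma good_base (M : ℝ) (μ : Fin k → ℂ) (n : Fin k → ℕ) (Θ : Ang k)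
    (h : ∀ j, 2 * M ≤ (μ j).re) : GoodC M μ n Θ := by
  refine ⟨1, one_ne_zero, fun φ => ⟨fun s => ∫ a, φ a * Θ.f a * WW (fun j => 2 * s + μ j - 2) n a,
    ?_, fun s _ _ => by simp⟩⟩
  have e : ∀ (s : ℂ) (a : Fin k → ℂ), φ a * Θ.f a * WW (fun j => 2 * s + μ j - 2) n a =
      (φ a * Θ.f a * WW (fun j => μ j - 2) n a) *
        Complex.exp (s * ((∑ j, 2 * Real.log ‖a j‖ : ℝ) : ℂ)) := by
    intro s a
    rw [mul_assoc (φ a * Θ.f a)]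
    congr 1
    unfold WW wt
    push_cast
    rw [Finset.mul_sum, Complex.exp_sum, ← Finset.prod_mul_distrib]
    refine Finset.prod_congr rfl fun j _ => ?_
    rw [mul_right_comm, ← Complex.exp_add]
    ring_nf
  have m1 := φ.continuous.measurable
  have m2 := Θ.meas
  have m3 := WW_meas (fun j => μ j - 2) n
  have hl : Measurable (fun a : Fin k → ℂ => ∑ j, 2 * Real.log ‖a j‖) := by
    refine Finset.measurable_sum _ fun j _ => ?_
    exact (Real.measurable_log.comp (measurable_norm.comp (measurable_pi_apply j))).const_mul 2
  simp only [e]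
  refine holo_gen volume (fun a => φ a * Θ.f a * WW (fun j => μ j - 2) n a) _ (by fun_prop) hl (-M) ?_
  intro s hs
  simp only [← e]
  refine int_main Θ φ _ n fun j => re_aux _ _ ?_
  have := h j
  linarith

lemma good_step (M : ℝ) (μ : Fin k → ℂ) (j : Fin k)
    (ih : ∀ n Θ, GoodC M (Function.update μ j (μ j + 1)) n Θ) :
    ∀ (p : ℕ) (n : Fin k → ℕ) (Θ : Ang k), n j = p → GoodC M μ n Θ := by
  have upd : ∀ s : ℂ, Function.update (fun j => 2 * s + μ j - 2) j ((2 * s + μ j - 2) + 1) =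
      fun i => 2 * s + Function.update μ j (μ j + 1) i - 2 := by
    intro s; funext i
    by_cases h : i = j
    · subst h; simp; ring
    · simp [h]
  have reg : ∀ s : ℂ, (∀ i, 0 < 2 * s.re + (μ i).re) →
      ∀ i, 0 < 2 * s.re + (Function.update μ j (μ j + 1) i).re := by
    intro s hs i
    by_cases h : i = j
    · subst h; have := hs i; simp; linarith
    · simpa [h] using hs i
  have hQ0 : (Polynomial.C 2 * Polynomial.X + Polynomial.C (μ j) : Polynomial ℂ) ≠ 0 := by
    intro h
    have := congrArg (fun q => Polynomial.coeff q 1) h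
    simp [Polynomial.coeff_C] at this
  intro p
  induction p with
  | zero =>
    intro n Θ hn
    obtain ⟨Q1, hQ1, h1⟩ := ih n (Θ.re j)
    obtain ⟨Q2, hQ2, h2⟩ := ih n (Θ.im j)
    refine ⟨(Polynomial.C 2 * Polynomial.X + Polynomial.C (μ j)) * (Q1 * Q2),
      mul_ne_zero hQ0 (mul_ne_zero hQ1 hQ2), fun φ => ?_⟩
    obtain ⟨H1, d1, e1⟩ := h1 (dX j φ)
    obtain ⟨H2, d2, e2⟩ := h2 (dY j φ)
    refine ⟨fun s => -(Q2.eval s * H1 s) - Q1.eval s * H2 s, ?_, fun s hs hj => ?_⟩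
    · exact ((Q2.differentiable.differentiableOn.mul d1).neg).sub
        (Q1.differentiable.differentiableOn.mul d2)
    · have k1 := e1 s hs (reg s hj)
      have k2 := e2 s hs (reg s hj)
      have k0 := ibp2 Θ φ (fun j => 2 * s + μ j - 2) n (fun i => re_aux _ _ (hj i)) j
      simp only [upd, hn, Nat.cast_zero, zero_mul, sub_zero] at k0
      simp only [Polynomial.eval_mul, Polynomial.eval_add, Polynomial.eval_C, Polynomial.eval_X]
      linear_combination (Q1.eval s * Q2.eval s) * k0 - Q2.eval s * k1 - Q1.eval s * k2
  | succ q ihq =>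
    intro n Θ hn
    obtain ⟨Q1, hQ1, h1⟩ := ih n (Θ.re j)
    obtain ⟨Q2, hQ2, h2⟩ := ih n (Θ.im j)
    obtain ⟨Q3, hQ3, h3⟩ := ihq (Function.update n j (n j - 1)) Θ (by simp [hn])
    refine ⟨(Polynomial.C 2 * Polynomial.X + Polynomial.C (μ j)) * (Q1 * Q2 * Q3),
      mul_ne_zero hQ0 (mul_ne_zero (mul_ne_zero hQ1 hQ2) hQ3), fun φ => ?_⟩
    obtain ⟨H1, d1, e1⟩ := h1 (dX j φ)
    obtain ⟨H2, d2, e2⟩ := h2 (dY j φ)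
    obtain ⟨H3, d3, e3⟩ := h3 φ
    refine ⟨fun s => -((Q2 * Q3).eval s * H1 s) - (Q1 * Q3).eval s * H2 s
      - (Polynomial.C (n j : ℂ) * (Q1 * Q2)).eval s * H3 s, ?_, fun s hs hj => ?_⟩
    · exact (((Polynomial.differentiable _).differentiableOn.mul d1).neg.sub
        ((Polynomial.differentiable _).differentiableOn.mul d2)).sub
        ((Polynomial.differentiable _).differentiableOn.mul d3)
    · have k1 := e1 s hs (reg s hj)
      have k2 := e2 s hs (reg s hj)
      have k3 := e3 s hs hj
      have k0 := ibp2 Θ φ (fun j => 2 * s + μ j - 2) n (fun i => re_aux _ _ (hj i)) j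
      simp only [upd] at k0
      simp only [Polynomial.eval_mul, Polynomial.eval_add, Polynomial.eval_C, Polynomial.eval_X]
      linear_combination (Q1.eval s * Q2.eval s * Q3.eval s) * k0 - Q2.eval s * Q3.eval s * k1
        - Q1.eval s * Q3.eval s * k2 - (n j : ℂ) * Q1.eval s * Q2.eval s * k3

lemma ceil_aux (x : ℝ) (hx : 0 < x) : ⌈x - 1⌉₊ < ⌈x⌉₊ := by
  have h := Nat.ceil_pos.2 hx
  obtain ⟨q, hq⟩ : ∃ q, ⌈x⌉₊ = q + 1 := ⟨⌈x⌉₊ - 1, by omega⟩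
  rw [hq, Nat.lt_succ_iff, Nat.ceil_le]
  have := Nat.le_ceil x
  rw [hq] at this
  push_cast at this
  linarith

lemma good_all (M : ℝ) : ∀ (N : ℕ) (μ : Fin k → ℂ), ∑ j, ⌈2 * M - (μ j).re⌉₊ ≤ N →
    ∀ n Θ, GoodC M μ n Θ := by
  intro N
  induction N with
  | zero =>
    intro μ h n Θ
    refine good_base M μ n Θ fun j => ?_
    have h0 := Finset.sum_eq_zero_iff.1 (Nat.le_zero.1 h) j (Finset.mem_univ j)
    rw [Nat.ceil_eq_zero] at h0
    linarith
  | succ N ih =>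
    intro μ h n Θ
    by_cases hb : ∀ j, 2 * M ≤ (μ j).re
    · exact good_base M μ n Θ hb
    push Not at hb
    obtain ⟨j, hj⟩ := hb
    refine good_step M μ j (ih _ ?_) (n j) n Θ rfl
    refine Nat.lt_succ_iff.1 (lt_of_lt_of_le ?_ h)
    refine Finset.sum_lt_sum (fun i _ => ?_) ⟨j, Finset.mem_univ j, ?_⟩
    · by_cases hi : i = j
      · subst hi
        simp only [Function.update_self, Complex.add_re, Complex.one_re]
        exact Nat.ceil_mono (by linarith)
      · simp [hi]
    · simp only [Function.update_self, Complex.add_re, Complex.one_re]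
      rw [← sub_sub]
      exact ceil_aux _ (by linarith)

/-- the angular factor of the statement -/
noncomputable def angM (m : Fin k → ℕ) : Ang k where
  f a := ∏ j, (a j / (‖a j‖ : ℂ)) ^ (m j)
  meas := by
    refine Finset.measurable_prod _ fun j _ => ?_
    fun_prop
  bd a := by
    rw [norm_prod]
    refine Finset.prod_le_one (fun _ _ => norm_nonneg _) fun j _ => ?_
    rw [norm_pow, norm_div, Complex.norm_real, norm_norm]
    exact pow_le_one₀ (by positivity) (div_self_le_one _)
  inv j L a := by
    refine Finset.prod_congr rfl fun i _ => ?_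
    congr 1
    by_cases h : i = j
    · simp only [h, if_true, norm_mul, Complex.norm_real, Real.norm_of_nonneg (Real.exp_pos L).le]
      push_cast
      exact mul_div_mul_left _ _ (Complex.exp_ne_zero _)
    · simp [h]

lemma mellin_ae (lam : Fin k → ℂ) (m n : Fin k → ℕ) (φ : SchwartzMap (Fin k → ℂ) ℂ) (s : ℂ) :
    mellinIntegrandC k lam m n φ s =ᵐ[volume]
      fun a => φ a * (angM m).f a * WW (fun j => 2 * s + 2 * lam j - 2) n a := by
  filter_upwards [ae_all_iff.2 (fun j => ae_ne (k := k) j)] with a ha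
  rw [mellinIntegrandC, if_pos ha, mul_assoc]
  congr 1
  simp only [angM, WW]
  rw [← Finset.prod_mul_distrib]
  refine Finset.prod_congr rfl fun j _ => ?_
  have hn : (‖a j‖ : ℂ) ≠ 0 := by exact_mod_cast norm_ne_zero_iff.2 (ha j)
  rw [wt, Complex.cpow_def_of_ne_zero hn, ← Complex.ofReal_log (norm_nonneg _)]
  ring_nf

end

/-- (i) for every s with Re(s) > −Re(λ_j) for all j, the integrand of
F_φ(s) is Bochner integrable on ℂ^k (with respect to Lebesgue measure on ℂ^k ≅ ℝ^{2k});
(ii) for every M > 0 there is a nonzero polynomial Q, depending only on M, k and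
(λ_j, m_j, n_j) and not on φ, such that for each Schwartz φ there is H holomorphic on
{s : Re(s) > −M} with Q(s)·F_φ(s) = H(s) whenever Re(s) > −M and Re(s) > −Re(λ_j) for
all j; hence F_φ extends meromorphically to all of ℂ. -/
theorem mellinC_integrable_and_meromorphic (k : ℕ) (hk : 1 ≤ k) (lam : Fin k → ℂ)
    (m n : Fin k → ℕ) :
    (∀ (φ : SchwartzMap (Fin k → ℂ) ℂ) (s : ℂ), (∀ j, -(lam j).re < s.re) →
      Integrable (mellinIntegrandC k lam m n φ s) (volume : Measure (Fin k → ℂ))) ∧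
    (∀ M : ℝ, 0 < M →
      ∃ Q : Polynomial ℂ, Q ≠ 0 ∧
        ∀ φ : SchwartzMap (Fin k → ℂ) ℂ, ∃ H : ℂ → ℂ,
          DifferentiableOn ℂ H {s : ℂ | -M < s.re} ∧
          ∀ s : ℂ, -M < s.re → (∀ j, -(lam j).re < s.re) →
            Q.eval s * (∫ a, mellinIntegrandC k lam m n φ s a
                ∂(volume : Measure (Fin k → ℂ))) = H s) := by
  
  have reg : ∀ s : ℂ, (∀ j, -(lam j).re < s.re) → ∀ j, 0 < 2 * s.re + (2 * lam j).re := by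
    intro s hs j
    have := hs j
    simp; linarith
  refine ⟨fun φ s hs => ?_, fun M _ => ?_⟩
  · exact (int_main (angM m) φ _ n fun j => re_aux _ _ (reg s hs j)).congr
      (mellin_ae lam m n φ s).symm
  · obtain ⟨Q, hQ, h⟩ := good_all M _ (fun j => 2 * lam j) le_rfl n (angM m)
    refine ⟨Q, hQ, fun φ => ?_⟩
    obtain ⟨H, d, e⟩ := h φ
    refine ⟨H, d, fun s hs hj => ?_⟩
    rw [integral_congr_ae (mellin_ae lam m n φ s)]
    exact e s hs (reg s hj)
end

section
/- Let f : ℂ → ℂ be smooth as a function of two real variables (C^∞ over ℝ) and let k be a nonnegative integer. Then for every z ∈ ℂ, f(z) = Σ_{l=0}^{k} Σ_{j=0}^{l} (1/(j!·(l−j)!))·z^j·(conj z)^{l−j}·(∂^l f/∂z^j ∂z̄^{l−j})(0) + Σ_{j=0}^{k+1} ((k+1)/(j!·(k+1−j)!))·z^j·(conj z)^{k+1−j}·∫_0^1 (1−t)^k·(∂^{k+1} f/∂z^j ∂z̄^{k+1−j})(t·z) dt, where the integral over t ∈ [0,1] is taken with t real. -/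
/-- The Wirtinger derivative ∂/∂z as an operator on functions ℂ → ℂ (ℂ viewed as
a real vector space), defined via the real Fréchet derivative:
∂_x f(z) = Df(z)(1), ∂_y f(z) = Df(z)(i). -/
noncomputable def wirtingerDz (f : ℂ → ℂ) : ℂ → ℂ := fun z =>
  (1 / 2) * (fderiv ℝ f z 1 - Complex.I * fderiv ℝ f z Complex.I)

/-- The conjugate Wirtinger derivative ∂/∂z̄ as an operator on functions ℂ → ℂ. -/
noncomputable def wirtingerDzbar (f : ℂ → ℂ) : ℂ → ℂ := fun z =>
  (1 / 2) * (fderiv ℝ f z 1 + Complex.I * fderiv ℝ f z Complex.I)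

/-- Smooth functions ℂ → ℂ (over ℝ) as a complex vector space. -/
def smoothSub : Submodule ℂ (ℂ → ℂ) where
  carrier := {f | ContDiff ℝ (⊤ : ℕ∞) f}
  add_mem' := by
    intro a b ha hb
    simp only [Set.mem_ofPred_eq] at *
    exact ContDiff.add ha hb
  zero_mem' := by
    simp only [Set.mem_ofPred_eq]
    exact contDiff_const
  smul_mem' := by
    intro c f hf
    simp only [Set.mem_ofPred_eq] at *
    exact ContDiff.const_smul c hf

lemma smoothSub_prop (f : smoothSub) : ContDiff ℝ (⊤ : ℕ∞) f.1 := f.2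

lemma smooth_diff {f : ℂ → ℂ} (hf : ContDiff ℝ (⊤ : ℕ∞) f) : Differentiable ℝ f :=
  hf.differentiable (by simp)

lemma smooth_dir {f : ℂ → ℂ} (hf : ContDiff ℝ (⊤ : ℕ∞) f) (v : ℂ) :
    ContDiff ℝ (⊤ : ℕ∞) (fun w => fderiv ℝ f w v) :=
  (hf.fderiv_right (m := ((⊤ : ℕ∞) : WithTop ℕ∞)) (by simp)).clm_apply contDiff_const

/-- Directional derivative as an endomorphism of smooth functions. -/
noncomputable def dirD (v : ℂ) : Module.End ℂ smoothSub where
  toFun f := ⟨fun w => fderiv ℝ f.1 w v, smooth_dir f.2 v⟩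
  map_add' f g := by
    ext w
    simp [fderiv_add (smooth_diff f.2 w) (smooth_diff g.2 w)]
  map_smul' c f := by
    ext w
    simp [fderiv_const_smul (smooth_diff f.2 w) c]

lemma dirD_comm (u v : ℂ) : Commute (dirD u) (dirD v) := by
  ext f w
  have h2 : Differentiable ℝ (fderiv ℝ f.1) :=
    ((smoothSub_prop f).fderiv_right (m := ((⊤ : ℕ∞) : WithTop ℕ∞)) (by simp)).differentiable (by simp)
  have hs : IsSymmSndFDerivAt ℝ f.1 w :=
    ((smoothSub_prop f).contDiffAt).isSymmSndFDerivAt (by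
      simp only [minSmoothness_of_isRCLikeNormedField]
      exact WithTop.coe_le_coe.2 (le_top : (2 : ℕ∞) ≤ ⊤))
  change fderiv ℝ (fun w => fderiv ℝ f.1 w v) w u = fderiv ℝ (fun w => fderiv ℝ f.1 w u) w v
  rw [fderiv_clm_apply (h2 w) (differentiableAt_const _),
    fderiv_clm_apply (h2 w) (differentiableAt_const _)]
  simpa using hs.eq u v

noncomputable def endDz : Module.End ℂ smoothSub :=
  (1 / 2 : ℂ) • (dirD 1 + (-Complex.I) • dirD Complex.I)

noncomputable def endDzbar : Module.End ℂ smoothSub :=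
  (1 / 2 : ℂ) • (dirD 1 + Complex.I • dirD Complex.I)

lemma endDz_coe (f : smoothSub) : (endDz f : ℂ → ℂ) = wirtingerDz f := by
  ext w
  change 1 / 2 * (fderiv ℝ f.1 w 1 + (-Complex.I) * fderiv ℝ f.1 w Complex.I) = _
  rw [wirtingerDz]
  ring

lemma endDzbar_coe (f : smoothSub) : (endDzbar f : ℂ → ℂ) = wirtingerDzbar f := rfl

lemma endDz_pow_coe (n : ℕ) (f : smoothSub) :
    ((endDz ^ n) f : ℂ → ℂ) = wirtingerDz^[n] f := by
  induction n with
  | zero => rfl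
  | succ n ih => rw [pow_succ', Function.iterate_succ_apply', ← ih]; exact endDz_coe _

lemma endDzbar_pow_coe (n : ℕ) (f : smoothSub) :
    ((endDzbar ^ n) f : ℂ → ℂ) = wirtingerDzbar^[n] f := by
  induction n with
  | zero => rfl
  | succ n ih => rw [pow_succ', Function.iterate_succ_apply', ← ih]; rfl

lemma endDz_comm : Commute endDz endDzbar := by
  have h := dirD_comm 1 Complex.I
  have h1 : Commute (dirD 1 + (-Complex.I) • dirD Complex.I) (dirD 1 + Complex.I • dirD Complex.I) := by
    apply Commute.add_left
    · exact (Commute.refl _).add_right (h.smul_right _)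
    · exact (h.symm.smul_left _).add_right (((Commute.refl _).smul_right _).smul_left _)
  exact (h1.smul_right _).smul_left _

lemma dirD_eq (z : ℂ) : dirD z = z • endDz + (starRingEnd ℂ z) • endDzbar := by
  ext f w
  have hz : z = z.re • (1 : ℂ) + z.im • Complex.I := by
    simp
  have hc : starRingEnd ℂ z = z.re - z.im * Complex.I := by
    apply Complex.ext <;> simp
  have h1 : fderiv ℝ f.1 w z = z.re * fderiv ℝ f.1 w 1 + z.im * fderiv ℝ f.1 w Complex.I := by
    conv_lhs => rw [hz, map_add, map_smul, map_smul]
    simp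
  change fderiv ℝ f.1 w z = z * (1 / 2 * (fderiv ℝ f.1 w 1 + (-Complex.I) * fderiv ℝ f.1 w Complex.I))
    + starRingEnd ℂ z * (1 / 2 * (fderiv ℝ f.1 w 1 + Complex.I * fderiv ℝ f.1 w Complex.I))
  rw [h1, hc]
  have hz' : z = z.re + z.im * Complex.I := (Complex.re_add_im z).symm
  generalize fderiv ℝ f.1 w 1 = a
  generalize fderiv ℝ f.1 w Complex.I = b
  generalize z.re = x at *
  generalize z.im = y at *
  subst hz'
  linear_combination (y * b) * Complex.I_sq

lemma dirD_pow (z : ℂ) (m : ℕ) (f : smoothSub) (w : ℂ) :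
    ((dirD z ^ m) f : ℂ → ℂ) w = ∑ j ∈ Finset.range (m + 1),
      (m.choose j : ℂ) * z ^ j * (starRingEnd ℂ z) ^ (m - j) *
        (wirtingerDz^[j] (wirtingerDzbar^[m - j] f)) w := by
  have hc : Commute (z • endDz) ((starRingEnd ℂ z) • endDzbar) :=
    (endDz_comm.smul_right _).smul_left _
  rw [dirD_eq, hc.add_pow]
  simp only [LinearMap.sum_apply, Submodule.coe_sum, Finset.sum_apply]
  refine Finset.sum_congr rfl fun j _ => ?_
  rw [← endDzbar_pow_coe, ← endDz_pow_coe, ← nsmul_eq_mul']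
  simp only [smul_pow, LinearMap.smul_apply, smul_mul_smul_comm, Module.End.mul_apply,
    Submodule.coe_smul, Pi.smul_apply, smul_eq_mul, nsmul_eq_mul]
  simp
  ring

lemma dirD_hasDerivAt (z : ℂ) (m : ℕ) (f : smoothSub) (t : ℝ) :
    HasDerivAt (fun t : ℝ => ((dirD z ^ m) f : ℂ → ℂ) (t * z))
      (((dirD z ^ (m + 1)) f : ℂ → ℂ) (t * z)) t := by
  have h1 : HasDerivAt (fun t : ℝ => (t : ℂ) * z) z t := by
    simpa using (Complex.ofRealCLM.hasDerivAt (x := t)).mul_const z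
  have h2 := (smooth_diff ((dirD z ^ m) f).2 (t * z)).hasFDerivAt
  have h3 := h2.comp_hasDerivAt t h1
  rw [pow_succ']
  exact h3

lemma taylor_aux (g : ℕ → ℝ → ℂ) (hg : ∀ m t, HasDerivAt (g m) (g (m + 1) t) t) (k : ℕ) :
    g 0 1 = ∑ l ∈ Finset.range (k + 1), (1 / (l.factorial : ℂ)) * g l 0 +
      (1 / (k.factorial : ℂ)) * ∫ t in (0 : ℝ)..1, ((1 - t : ℝ) : ℂ) ^ k * g (k + 1) t := by
  have hcont : ∀ m, Continuous (g m) := fun m =>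
    continuous_iff_continuousAt.2 fun t => (hg m t).continuousAt
  induction k with
  | zero =>
    have := intervalIntegral.integral_eq_sub_of_hasDerivAt (a := 0) (b := 1)
      (fun t _ => hg 0 t) ((hcont 1).intervalIntegrable _ _)
    simp [this]
  | succ k ih =>
    rw [ih, Finset.sum_range_succ _ (k + 1), add_assoc]
    congr 1
    have hu : ∀ t : ℝ, HasDerivAt (fun t : ℝ => ((1 - t : ℝ) : ℂ) ^ (k + 1))
        (-((k + 1 : ℂ) * ((1 - t : ℝ) : ℂ) ^ k)) t := by
      intro t
      have h1 : HasDerivAt (fun t : ℝ => ((1 - t : ℝ) : ℂ)) (-1) t := by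
        have := ((hasDerivAt_id t).const_sub 1).ofReal_comp
        simpa using this
      refine HasDerivAt.congr_deriv (h1.pow (k + 1)) ?_
      push_cast
      simp
    have hi1 : IntervalIntegrable (fun t : ℝ => ((1 - t : ℝ) : ℂ) ^ k * g (k + 1) t)
        MeasureTheory.volume 0 1 := by
      have := hcont (k + 1)
      exact (by fun_prop : Continuous _).intervalIntegrable _ _
    have hi2 : IntervalIntegrable (fun t : ℝ => ((1 - t : ℝ) : ℂ) ^ (k + 1) * g (k + 2) t)
        MeasureTheory.volume 0 1 := by
      have := hcont (k + 2)
      exact (by fun_prop : Continuous _).intervalIntegrable _ _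
    have key := intervalIntegral.integral_eq_sub_of_hasDerivAt (a := 0) (b := 1)
      (f := fun t : ℝ => ((1 - t : ℝ) : ℂ) ^ (k + 1) * g (k + 1) t)
      (f' := fun t : ℝ => -((k + 1 : ℂ) * (((1 - t : ℝ) : ℂ) ^ k * g (k + 1) t)) +
        ((1 - t : ℝ) : ℂ) ^ (k + 1) * g (k + 2) t)
      (fun t _ => by
        refine HasDerivAt.congr_deriv ((hu t).mul (hg (k + 1) t)) ?_
        ring) ((hi1.const_mul _).neg.add hi2)
    have hadd := intervalIntegral.integral_add (hi1.const_mul (k + 1 : ℂ)).neg hi2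
    simp only [Pi.neg_apply] at hadd
    rw [hadd, intervalIntegral.integral_neg,
      intervalIntegral.integral_const_mul] at key
    simp only [sub_self, sub_zero, Complex.ofReal_zero, Complex.ofReal_one, one_pow, one_mul,
      zero_pow (Nat.succ_ne_zero k), zero_mul, zero_sub] at key
    have hk : (k.factorial : ℂ) ≠ 0 := by exact_mod_cast k.factorial_ne_zero
    have hk1 : (k + 1 : ℂ) ≠ 0 := by exact_mod_cast k.succ_ne_zero
    rw [Nat.factorial_succ]
    push_cast at key ⊢
    field_simp
    linear_combination -key

/-- Taylor expansion with integral remainder in terms of Wirtinger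
derivatives: for f : ℂ → ℂ smooth over ℝ and k ∈ ℕ, for every z ∈ ℂ,
f(z) = Σ_{l=0}^{k} Σ_{j=0}^{l} (1/(j!(l−j)!))·z^j·z̄^{l−j}·(∂^l f/∂z^j ∂z̄^{l−j})(0)
 + Σ_{j=0}^{k+1} ((k+1)/(j!(k+1−j)!))·z^j·z̄^{k+1−j}·∫_0^1 (1−t)^k·(∂^{k+1} f/∂z^j ∂z̄^{k+1−j})(t·z) dt. -/
theorem wirtinger_taylor (f : ℂ → ℂ) (hf : ContDiff ℝ (⊤ : ℕ∞) f) (k : ℕ) (z : ℂ) :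
    f z =
      (∑ l ∈ Finset.range (k + 1), ∑ j ∈ Finset.range (l + 1),
          (1 / ((j.factorial : ℂ) * ((l - j).factorial : ℂ))) * z ^ j *
            ((starRingEnd ℂ) z) ^ (l - j) * (wirtingerDz^[j] (wirtingerDzbar^[l - j] f)) 0) +
      ∑ j ∈ Finset.range (k + 2),
        (((k : ℂ) + 1) / ((j.factorial : ℂ) * ((k + 1 - j).factorial : ℂ))) * z ^ j *
          ((starRingEnd ℂ) z) ^ (k + 1 - j) *
          ∫ t in (0 : ℝ)..1,
            ((1 - t : ℝ) : ℂ) ^ k * (wirtingerDz^[j] (wirtingerDzbar^[k + 1 - j] f)) ((t : ℂ) * z) := by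
  have h := taylor_aux (fun m t => ((dirD z ^ m) (⟨f, hf⟩ : smoothSub) : ℂ → ℂ) (t * z))
    (fun m t => dirD_hasDerivAt z m ⟨f, hf⟩ t) k
  have h0 : ((dirD z ^ 0) (⟨f, hf⟩ : smoothSub) : ℂ → ℂ) (((1 : ℝ) : ℂ) * z) = f z := by
    simp
  have hch : ∀ m j, j ∈ Finset.range (m + 1) →
      (m.choose j : ℂ) = m.factorial / (j.factorial * (m - j).factorial) := by
    intro m j hj
    exact Nat.cast_choose ℂ (Nat.lt_succ_iff.1 (Finset.mem_range.1 hj))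
  have hfac : ∀ m : ℕ, (m.factorial : ℂ) ≠ 0 := fun m => by exact_mod_cast m.factorial_ne_zero
  beta_reduce at h
  rw [h0] at h
  rw [h]
  congr 1
  · refine Finset.sum_congr rfl fun l _ => ?_
    rw [dirD_pow, Finset.mul_sum]
    refine Finset.sum_congr rfl fun j hj => ?_
    rw [hch l j hj]
    have := hfac l
    have := hfac j
    have := hfac (l - j)
    simp only [Complex.ofReal_zero, zero_mul]
    field_simp
  · simp only [dirD_pow, Finset.mul_sum]
    rw [intervalIntegral.integral_finsetSum, Finset.mul_sum]
    · refine Finset.sum_congr rfl fun j hj => ?_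
      have e : ∀ t : ℝ, ((1 - t : ℝ) : ℂ) ^ k * (((k + 1).choose j : ℂ) * z ^ j *
          (starRingEnd ℂ z) ^ (k + 1 - j) *
            (wirtingerDz^[j] (wirtingerDzbar^[k + 1 - j] f)) (t * z)) =
          (((k + 1).choose j : ℂ) * z ^ j * (starRingEnd ℂ z) ^ (k + 1 - j)) *
          (((1 - t : ℝ) : ℂ) ^ k *
            (wirtingerDz^[j] (wirtingerDzbar^[k + 1 - j] f)) (t * z)) := fun t => by ring
      simp only [e]
      rw [intervalIntegral.integral_const_mul, hch (k + 1) j hj, Nat.factorial_succ]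
      have := hfac k
      have := hfac j
      have := hfac (k + 1 - j)
      generalize (∫ t in (0 : ℝ)..1, ((1 - t : ℝ) : ℂ) ^ k *
        (wirtingerDz^[j] (wirtingerDzbar^[k + 1 - j] f)) ((t : ℂ) * z)) = J
      push_cast
      field_simp
    · intro j _
      have hc : Continuous (wirtingerDz^[j] (wirtingerDzbar^[k + 1 - j] f)) := by
        have := ((endDz ^ j) ((endDzbar ^ (k + 1 - j)) (⟨f, hf⟩ : smoothSub))).2
        rw [endDz_pow_coe, endDzbar_pow_coe] at this
        exact (smooth_diff this).continuous
      exact (by fun_prop : Continuous _).intervalIntegrable _ _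
end

section
/- Let N be a lower triangular (n−1)×(n−1) matrix over F, let Z be a strictly lower triangular (n−1)×(n−1) matrix over F (lower triangular with zero diagonal), and let y ∈ F^{n−1} be a row vector. Then the (2n−1)×(2n−1) matrix σ′·B·σ′^{−1}, where B is the block matrix with block rows [N, 0, Z], [0, 0, y], [0, 0, N], is lower triangular. -/
/-- The 0-based index form of the permutation ρ of {1,…,2n}: ρ(a) = 2a−1 for
1 ≤ a ≤ n and ρ(a) = 2(a−n) for n < a ≤ 2n. In 0-based indexing this sends
i ↦ 2i for i < n and i ↦ 2(i−n)+1 for i ≥ n. -/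
def rhoVal (n i : ℕ) : ℕ := if i < n then 2 * i else 2 * (i - n) + 1

/-- The (2n−1)×(2n−1) permutation matrix σ′ of the restriction of ρ to {1,…,2n−1},
characterized by σ′·e_a = e_{ρ(a)}. -/
def sigmaP (F : Type*) [Zero F] [One F] (n : ℕ) :
    Matrix (Fin (2 * n - 1)) (Fin (2 * n - 1)) F :=
  Matrix.of fun i j => if (i : ℕ) = rhoVal n (j : ℕ) then 1 else 0

/-- The (2n−1)×(2n−1) block matrix with block rows [N, 0, Z], [0, 0, y], [0, 0, N]
with respect to the decomposition of the index set into blocks of sizes n−1, 1, n−1. -/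
def blockNZy (F : Type*) [Zero F] (n : ℕ)
    (N Z : Matrix (Fin (n - 1)) (Fin (n - 1)) F) (y : Fin (n - 1) → F) :
    Matrix (Fin (2 * n - 1)) (Fin (2 * n - 1)) F :=
  Matrix.of fun i j =>
    if hi : (i : ℕ) < n - 1 then
      if hj : (j : ℕ) < n - 1 then N ⟨i, hi⟩ ⟨j, hj⟩
      else if hj2 : n ≤ (j : ℕ) then
        Z ⟨i, hi⟩ ⟨(j : ℕ) - n, by have := j.isLt; omega⟩
      else 0
    else if (i : ℕ) = n - 1 then
      if hj2 : n ≤ (j : ℕ) then y ⟨(j : ℕ) - n, by have := j.isLt; omega⟩ else 0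
    else
      if hi2 : n ≤ (i : ℕ) then
        if hj2 : n ≤ (j : ℕ) then
          N ⟨(i : ℕ) - n, by have := i.isLt; omega⟩ ⟨(j : ℕ) - n, by have := j.isLt; omega⟩
        else 0
      else 0

/-- if N is lower triangular, Z is strictly lower triangular (both of
size (n−1)×(n−1) over a field F) and y ∈ F^{n−1}, then σ′·B·σ′^{−1} is lower
triangular, where B has block rows [N, 0, Z], [0, 0, y], [0, 0, N]. -/
theorem sigma_conj_lower_triangular (F : Type*) [Field F] (n : ℕ) (hn : 2 ≤ n)
    (N Z : Matrix (Fin (n - 1)) (Fin (n - 1)) F)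
    (hN : ∀ i j : Fin (n - 1), i < j → N i j = 0)
    (hZ : ∀ i j : Fin (n - 1), i ≤ j → Z i j = 0)
    (y : Fin (n - 1) → F) :
    ∀ i j : Fin (2 * n - 1), i < j →
      (sigmaP F n * blockNZy F n N Z y * (sigmaP F n)⁻¹) i j = 0 := by
  intro i j hij
  have hS : (sigmaP F n).transpose * sigmaP F n = 1 := by
    ext a b
    have ha := a.isLt
    have hb := b.isLt
    have hr : rhoVal n a < 2 * n - 1 := by unfold rhoVal; split_ifs <;> omega
    rw [Matrix.mul_apply, Finset.sum_eq_single (⟨rhoVal n a, hr⟩ : Fin (2 * n - 1))]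
    · simp only [Matrix.transpose_apply, sigmaP, Matrix.of_apply, if_true, one_mul,
        Matrix.one_apply]
      have : rhoVal n a = rhoVal n b ↔ a = b := by
        rw [Fin.ext_iff]
        unfold rhoVal
        split_ifs <;> omega
      simp only [this]
    · intro c _ hc
      have : ¬ ((c : ℕ) = rhoVal n a) := fun h => hc (Fin.ext h)
      simp [sigmaP, this]
    · simp
  rw [Matrix.inv_eq_left_inv hS, Matrix.mul_apply]
  refine Finset.sum_eq_zero fun b _ => ?_
  rw [Matrix.mul_apply, Finset.sum_mul]
  refine Finset.sum_eq_zero fun a _ => ?_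
  simp only [Matrix.transpose_apply, sigmaP, Matrix.of_apply]
  by_cases h1 : (i : ℕ) = rhoVal n a
  swap
  · simp [h1]
  by_cases h2 : (j : ℕ) = rhoVal n b
  swap
  · simp [h2]
  have hlt : rhoVal n a < rhoVal n b := by rw [← h1, ← h2]; exact hij
  have ha := a.isLt
  have hb := b.isLt
  have hB : blockNZy F n N Z y a b = 0 := by
    unfold rhoVal at hlt
    simp only [blockNZy, Matrix.of_apply]
    split_ifs at hlt ⊢ <;> first
      | rfl
      | omega
      | (apply hN; rw [Fin.lt_def]; simp only; omega)
      | (apply hZ; rw [Fin.le_def]; simp only; omega)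
  rw [hB]
  simp
end

section
/- Let b, c, n be nonnegative integers, m ∈ ℤ, and w ∈ ℂ with 2·Re(w) + b + c > 0. Then ∫_{{a ∈ ℂ : 0 < ‖a‖ < 1}} a^b·(conj a)^c·(a/‖a‖)^m·‖a‖^{2w−2}·(log‖a‖)^n da equals 2π·(−1)^n·n!/(2w+b+c)^{n+1} if m + b − c = 0, and equals 0 if m + b − c ≠ 0. -/
open MeasureTheory Set Filter Topology

theorem cmud_tendsto (n : ℕ) {s : ℂ} (hs : 0 < s.re) :
    Tendsto (fun t : ℝ => (t : ℂ) ^ n * Complex.exp (-s * t)) atTop (𝓝 0) := by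
  rw [tendsto_zero_iff_norm_tendsto_zero]
  have h := (isLittleO_pow_exp_pos_mul_atTop n hs).tendsto_div_nhds_zero
  refine h.congr' ?_
  filter_upwards [eventually_gt_atTop 0] with t ht
  rw [norm_mul, norm_pow, Complex.norm_real, Complex.norm_exp, Real.norm_of_nonneg ht.le,
    div_eq_mul_inv, ← Real.exp_neg]
  simp

theorem cmud_integrable (n : ℕ) {s : ℂ} (hs : 0 < s.re) :
    IntegrableOn (fun t : ℝ => (t : ℂ) ^ n * Complex.exp (-s * t)) (Ioi 0) := by
  have h := integrableOn_rpow_mul_exp_neg_mul_rpow (p := 1) (s := n) (b := s.re)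
    (by have : (0:ℝ) ≤ n := n.cast_nonneg
        linarith) one_pos hs
  refine Integrable.mono' h (by fun_prop) ?_
  filter_upwards [ae_restrict_mem measurableSet_Ioi] with t ht
  have ht : 0 < t := ht
  rw [norm_mul, norm_pow, Complex.norm_real, Complex.norm_exp, Real.norm_of_nonneg ht.le]
  simp

theorem cmud_laplace (n : ℕ) {s : ℂ} (hs : 0 < s.re) :
    ∫ t : ℝ in Ioi 0, (t : ℂ) ^ n * Complex.exp (-s * t) = n.factorial / s ^ (n + 1) := by
  have hs0 : s ≠ 0 := by rintro rfl; simp at hs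
  induction n with
  | zero =>
    have := integral_exp_mul_complex_Ioi (a := -s) (by simpa using hs) 0
    simpa using this
  | succ n ih =>
    have hu : ∀ x ∈ Ioi (0:ℝ), HasDerivAt (fun t : ℝ => (t : ℂ) ^ (n + 1))
        ((n + 1 : ℕ) * (x : ℂ) ^ n) x := fun x _ => by
      simpa using (hasDerivAt_pow (n + 1) (x : ℂ)).comp_ofReal
    have hv : ∀ x ∈ Ioi (0:ℝ), HasDerivAt (fun t : ℝ => -Complex.exp (-s * t) / s)
        (Complex.exp (-s * x)) x := fun x _ => by
      have h1 : HasDerivAt (fun z : ℂ => -Complex.exp (-s * z) / s)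
        (-(Complex.exp (-s * x) * (-s * 1)) / s) (x : ℂ) :=
        (((hasDerivAt_id (x : ℂ)).const_mul (-s)).cexp.neg).div_const s
      convert! h1.comp_ofReal using 1
      field_simp
    have hlim : Tendsto (fun t : ℝ => (t : ℂ) ^ (n + 1) * (-Complex.exp (-s * t) / s))
        atTop (𝓝 0) := by
      have := (cmud_tendsto (n + 1) hs).mul_const (-1 / s)
      rw [zero_mul] at this
      refine this.congr fun t => ?_
      ring
    have hlim0 : Tendsto (fun t : ℝ => (t : ℂ) ^ (n + 1) * (-Complex.exp (-s * t) / s))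
        (𝓝[>] 0) (𝓝 0) := by
      have : Continuous (fun t : ℝ => (t : ℂ) ^ (n + 1) * (-Complex.exp (-s * t) / s)) := by
        fun_prop
      have h := (this.tendsto 0).mono_left (nhdsWithin_le_nhds (s := Ioi 0))
      simpa using h
    have e : ∀ x : ℝ, ((n + 1 : ℕ) * (x : ℂ) ^ n) * (-Complex.exp (-s * x) / s)
        = (-((n + 1 : ℕ) : ℂ) / s) * ((x : ℂ) ^ n * Complex.exp (-s * x)) := fun x => by ring
    have key := integral_Ioi_mul_deriv_eq_deriv_mul hu hv (cmud_integrable (n + 1) hs)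
      (by
        refine IntegrableOn.congr_fun ((cmud_integrable n hs).const_mul
          (-((n + 1 : ℕ) : ℂ) / s)) (fun x _ => (e x).symm) measurableSet_Ioi) hlim0 hlim
    rw [key]
    simp_rw [e]
    rw [integral_const_mul, ih, Nat.factorial_succ]
    push_cast
    field_simp
    ring

theorem cmud_radial (n : ℕ) {s : ℂ} (hs : 0 < s.re) :
    ∫ r : ℝ in Ioo 0 1, (r : ℂ) ^ (s - 1) * ((Real.log r : ℝ) : ℂ) ^ n
      = (-1) ^ n * n.factorial / s ^ (n + 1) := by
  have him : (fun t : ℝ => Real.exp (-t)) '' Ioi 0 = Ioo 0 1 := by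
    ext r
    constructor
    · rintro ⟨t, ht, rfl⟩
      exact ⟨Real.exp_pos _, by simpa using ht⟩
    · rintro ⟨h0, h1⟩
      exact ⟨-Real.log r, by simpa using Real.log_neg h0 h1, by simp [Real.exp_log h0]⟩
  have hd : ∀ x ∈ Ioi (0:ℝ), HasDerivWithinAt (fun t : ℝ => Real.exp (-t))
      (-Real.exp (-x)) (Ioi 0) x := fun x _ => by
    simpa using ((hasDerivAt_id x).neg.exp).hasDerivWithinAt
  rw [← him, integral_image_eq_integral_abs_deriv_smul measurableSet_Ioi hd
    (fun x _ y _ h => by simpa using h)]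
  have e : ∀ t : ℝ, |-Real.exp (-t)| • ((Real.exp (-t) : ℂ) ^ (s - 1) *
      ((Real.log (Real.exp (-t)) : ℝ) : ℂ) ^ n)
      = (-1) ^ n * ((t : ℂ) ^ n * Complex.exp (-s * t)) := fun t => by
    rw [abs_neg, abs_of_pos (Real.exp_pos _), Real.log_exp, Complex.real_smul,
      Complex.cpow_def_of_ne_zero (by exact_mod_cast (Real.exp_pos _).ne'),
      ← Complex.ofReal_log (Real.exp_pos _).le, Real.log_exp, Complex.ofReal_exp,
      ← mul_assoc, ← Complex.exp_add, Complex.ofReal_neg, neg_pow (t : ℂ) n]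
    rw [show -(t : ℂ) + -(t : ℂ) * (s - 1) = -s * t by ring]
    ring
  simp_rw [e]
  rw [integral_const_mul, cmud_laplace n hs]
  ring

theorem cmud_angular (k : ℤ) :
    ∫ θ : ℝ in Ioo (-Real.pi) Real.pi, Complex.exp (θ * Complex.I) ^ k
      = if k = 0 then 2 * (Real.pi : ℂ) else 0 := by
  rw [← integral_Ioc_eq_integral_Ioo,
    ← intervalIntegral.integral_of_le (by linarith [Real.pi_pos])]
  split_ifs with hk
  · subst hk
    simp
    ring
  · have hc : (k : ℂ) * Complex.I ≠ 0 := by simp [hk]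
    have e : ∀ θ : ℝ, Complex.exp (θ * Complex.I) ^ k
        = Complex.exp ((k : ℂ) * Complex.I * θ) := fun θ => by
      rw [← Complex.exp_int_mul]
      ring_nf
    simp_rw [e]
    rw [integral_exp_mul_complex hc, div_eq_zero_iff]
    left
    rw [sub_eq_zero, Complex.exp_eq_exp_iff_exists_int]
    exact ⟨k, by push_cast; ring⟩

theorem cmud_pointwise (b c n : ℕ) (m : ℤ) (w : ℂ) (r θ : ℝ) (hr : 0 < r) :
    (r : ℂ) * ((r * Complex.exp (θ * Complex.I)) ^ b *
      ((starRingEnd ℂ) (r * Complex.exp (θ * Complex.I))) ^ c *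
      (r * Complex.exp (θ * Complex.I) / (r : ℂ)) ^ m *
      (r : ℂ) ^ (2 * w - 2) * ((Real.log r : ℝ) : ℂ) ^ n)
    = ((r : ℂ) ^ ((2 * w + b + c) - 1) * ((Real.log r : ℝ) : ℂ) ^ n) *
      Complex.exp (θ * Complex.I) ^ (m + (b : ℤ) - (c : ℤ)) := by
  have hr0 : (r : ℂ) ≠ 0 := by exact_mod_cast hr.ne'
  have he := Complex.exp_ne_zero (θ * Complex.I)
  have hconj : (starRingEnd ℂ) (Complex.exp (θ * Complex.I))
      = (Complex.exp (θ * Complex.I))⁻¹ := by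
    rw [← Complex.exp_conj, ← Complex.exp_neg]
    simp
  rw [map_mul, hconj, Complex.conj_ofReal, mul_div_cancel_left₀ _ hr0,
    show (2 * w + b + c) - 1 = (2 * w - 2) + ((b + c + 1 : ℕ) : ℂ) by push_cast; ring,
    Complex.cpow_add _ _ hr0, Complex.cpow_natCast, zpow_sub₀ he, zpow_add₀ he,
    zpow_natCast, zpow_natCast, mul_pow, mul_pow, inv_pow]
  field_simp
  ring


/-- for nonnegative integers b, c, n, an integer m, and w ∈ ℂ with
2·Re(w) + b + c > 0, the integral over the punctured open unit disk
∫ a^b·(conj a)^c·(a/‖a‖)^m·‖a‖^{2w−2}·(log‖a‖)^n da (with respect to Lebesgue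
measure on ℂ ≅ ℝ²) equals 2π·(−1)^n·n!/(2w+b+c)^{n+1} if m + b − c = 0, and 0
otherwise. -/
theorem complex_mellin_unit_disk (b c n : ℕ) (m : ℤ) (w : ℂ)
    (hw : 0 < 2 * w.re + b + c) :
    (∫ a in {a : ℂ | 0 < ‖a‖ ∧ ‖a‖ < 1},
        a ^ b * ((starRingEnd ℂ) a) ^ c * (a / (‖a‖ : ℂ)) ^ m *
          ((‖a‖ : ℝ) : ℂ) ^ (2 * w - 2) * ((Real.log ‖a‖ : ℝ) : ℂ) ^ n) =
      if m + (b : ℤ) - (c : ℤ) = 0 then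
        2 * (Real.pi : ℂ) * (-1) ^ n * (n.factorial : ℂ) / (2 * w + b + c) ^ (n + 1)
      else 0 := by
  have hset : MeasurableSet {a : ℂ | 0 < ‖a‖ ∧ ‖a‖ < 1} :=
    (measurableSet_lt measurable_const measurable_norm).inter
      (measurableSet_lt measurable_norm measurable_const)
  have hs : 0 < (2 * w + b + c).re := by simpa using hw
  rw [← integral_indicator hset, ← Complex.integral_comp_polarCoord_symm]
  have e : ∀ p ∈ polarCoord.target, p.1 • indicator {a : ℂ | 0 < ‖a‖ ∧ ‖a‖ < 1} (fun a : ℂ =>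
        a ^ b * ((starRingEnd ℂ) a) ^ c * (a / (‖a‖ : ℂ)) ^ m *
          ((‖a‖ : ℝ) : ℂ) ^ (2 * w - 2) * ((Real.log ‖a‖ : ℝ) : ℂ) ^ n)
          (Complex.polarCoord.symm p)
      = indicator (Iio 1) (fun r : ℝ => (r : ℂ) ^ ((2 * w + b + c) - 1) *
          ((Real.log r : ℝ) : ℂ) ^ n) p.1 *
        (fun θ : ℝ => Complex.exp (θ * Complex.I) ^ (m + (b : ℤ) - (c : ℤ))) p.2 := by
    rintro ⟨r, θ⟩ hp
    have hr : 0 < r := hp.1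
    have hsymm : Complex.polarCoord.symm (r, θ) = r * Complex.exp (θ * Complex.I) := by
      rw [Complex.polarCoord_symm_apply, Complex.exp_mul_I]
      push_cast
      rfl
    have hnorm : ‖(r : ℂ) * Complex.exp (θ * Complex.I)‖ = r := by
      rw [norm_mul, Complex.norm_exp_ofReal_mul_I, Complex.norm_real,
        Real.norm_of_nonneg hr.le, mul_one]
    rw [hsymm]
    by_cases h1 : r < 1
    · rw [indicator_of_mem (by simp only [mem_ofPred_eq, hnorm]; exact ⟨hr, h1⟩),
        indicator_of_mem (by exact h1), hnorm, Complex.real_smul]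
      exact cmud_pointwise b c n m w r θ hr
    · rw [indicator_of_notMem (by simp only [mem_ofPred_eq, hnorm]; exact fun h => h1 h.2),
        indicator_of_notMem (by exact h1)]
      simp
  rw [setIntegral_congr_fun polarCoord.open_target.measurableSet e, polarCoord_target,
    Measure.volume_eq_prod]
  refine (setIntegral_prod_mul (μ := (volume : Measure ℝ)) (ν := (volume : Measure ℝ))
    (indicator (Iio 1) (fun r : ℝ => (r : ℂ) ^ ((2 * w + b + c) - 1) *
          ((Real.log r : ℝ) : ℂ) ^ n))
    (fun θ : ℝ => Complex.exp (θ * Complex.I) ^ (m + (b : ℤ) - (c : ℤ)))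
    (Ioi 0) (Ioo (-Real.pi) Real.pi)).trans ?_
  rw [setIntegral_indicator measurableSet_Iio,
    Ioi_inter_Iio, cmud_radial n hs, cmud_angular]
  split_ifs
  · ring
  · simp
end

section
/- For every invertible m×m real matrix g, every u ∈ N_m, and every 1 ≤ i ≤ m−1, λ_i(u·g) = u_{i,i+1} + λ_i(g). -/
open Matrix

/-- Bottom-up Gram–Schmidt applied to the rows of an m×m real matrix g:
w_m(g) = v_m(g) and, for i < m,
w_i(g) = v_i(g) − Σ_{j>i} (⟨v_i(g), w_j(g)⟩/⟨w_j(g), w_j(g)⟩)·w_j(g),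
where v_i(g) is the i-th row of g and ⟨·,·⟩ is the standard inner product
(dot product) on ℝ^m. -/
noncomputable def gramW {m : ℕ} (g : Matrix (Fin m) (Fin m) ℝ) (i : Fin m) :
    Fin m → ℝ :=
  g i - ∑ j : Fin m,
    if h : i < j then ((g i ⬝ᵥ gramW g j) / (gramW g j ⬝ᵥ gramW g j)) • gramW g j
    else 0
termination_by m - (i : ℕ)
decreasing_by
  all_goals
    have h1 : (i : ℕ) < (j : ℕ) := h
    have h2 := j.isLt
    omega

/-- λ_i(g) = ⟨v_i(g), w_{i+1}(g)⟩/⟨w_{i+1}(g), w_{i+1}(g)⟩ (0-based index i with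
i + 1 < m). -/
noncomputable def gramLambda {m : ℕ} (g : Matrix (Fin m) (Fin m) ℝ) (i : ℕ)
    (hi : i + 1 < m) : ℝ :=
  (g ⟨i, by omega⟩ ⬝ᵥ gramW g ⟨i + 1, hi⟩) /
    (gramW g ⟨i + 1, hi⟩ ⬝ᵥ gramW g ⟨i + 1, hi⟩)

/-- The Gram–Schmidt coefficient. -/
noncomputable def gramC {m : ℕ} (g : Matrix (Fin m) (Fin m) ℝ) (x : Fin m → ℝ) (j : Fin m) : ℝ :=
  (x ⬝ᵥ gramW g j) / (gramW g j ⬝ᵥ gramW g j)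

theorem gramW_eq {m : ℕ} (g : Matrix (Fin m) (Fin m) ℝ) (i : Fin m) :
    gramW g i = g i - ∑ j : Fin m, if i < j then gramC g (g i) j • gramW g j else 0 := by
  rw [gramW]
  simp only [gramC, dite_eq_ite]

theorem down_ind {m : ℕ} (P : Fin m → Prop) (h : ∀ i, (∀ j, i < j → P j) → P i) (i : Fin m) :
    P i := by
  induction i using WellFoundedGT.induction with
  | ind i ih => exact h i ih

theorem gramC_mul {m : ℕ} (g : Matrix (Fin m) (Fin m) ℝ) (x : Fin m → ℝ) (j : Fin m) :
    gramC g x j * (gramW g j ⬝ᵥ gramW g j) = x ⬝ᵥ gramW g j := by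
  unfold gramC
  by_cases h : gramW g j ⬝ᵥ gramW g j = 0
  · rw [dotProduct_self_eq_zero] at h
    simp [h]
  · field_simp

theorem gramW_orth {m : ℕ} (g : Matrix (Fin m) (Fin m) ℝ) :
    ∀ i k : Fin m, i < k → gramW g i ⬝ᵥ gramW g k = 0 := by
  refine down_ind _ ?_
  intro i ih k hk
  rw [gramW_eq g i, sub_dotProduct, sum_dotProduct, Finset.sum_eq_single k]
  · rw [if_pos hk, smul_dotProduct, smul_eq_mul, gramC_mul, sub_self]
  · intro j _ hj
    split_ifs with hij
    · rw [smul_dotProduct]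
      rcases lt_or_gt_of_ne hj with h | h
      · rw [ih j hij k h, smul_zero]
      · rw [dotProduct_comm, ih k hk j h, smul_zero]
    · simp
  · simp

theorem gramW_orth' {m : ℕ} (g : Matrix (Fin m) (Fin m) ℝ) (i k : Fin m) (h : i ≠ k) :
    gramW g i ⬝ᵥ gramW g k = 0 := by
  rcases lt_or_gt_of_ne h with h | h
  · exact gramW_orth g i k h
  · rw [dotProduct_comm]; exact gramW_orth g k i h

theorem row_eq {m : ℕ} (g : Matrix (Fin m) (Fin m) ℝ) (i : Fin m) :
    g i = gramW g i + ∑ j : Fin m, if i < j then gramC g (g i) j • gramW g j else 0 := by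
  rw [gramW_eq g i, sub_add_cancel]

theorem row_dot {m : ℕ} (g : Matrix (Fin m) (Fin m) ℝ) (j k : Fin m) (h : k ≤ j) :
    g j ⬝ᵥ gramW g k = gramW g j ⬝ᵥ gramW g k := by
  rw [row_eq g j, add_dotProduct, sum_dotProduct, Finset.sum_eq_zero, add_zero]
  intro l _
  split_ifs with hl
  · rw [smul_dotProduct, gramW_orth' g l k (by omega), smul_zero]
  · simp

theorem gramC_self {m : ℕ} (g : Matrix (Fin m) (Fin m) ℝ) (l : Fin m) :
    gramC g (g l) l • gramW g l = gramW g l := by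
  unfold gramC
  rw [row_dot g l l le_rfl]
  by_cases h : gramW g l ⬝ᵥ gramW g l = 0
  · rw [dotProduct_self_eq_zero] at h
    simp [h]
  · rw [div_self h, one_smul]

theorem gramC_low {m : ℕ} (g : Matrix (Fin m) (Fin m) ℝ) (l j : Fin m) (h : j < l) :
    gramC g (g l) j = 0 := by
  unfold gramC
  rw [row_dot g l j h.le, gramW_orth' g l j h.ne', zero_div]

theorem row_full {m : ℕ} (g : Matrix (Fin m) (Fin m) ℝ) (l : Fin m) :
    g l = ∑ j : Fin m, gramC g (g l) j • gramW g j := by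
  conv_lhs => rw [row_eq g l]
  rw [← Finset.add_sum_erase _ _ (Finset.mem_univ l), if_neg (lt_irrefl _), zero_add,
    ← Finset.add_sum_erase Finset.univ (fun j => gramC g (g l) j • gramW g j)
      (Finset.mem_univ l), gramC_self]
  congr 1
  refine Finset.sum_congr rfl fun j hj => ?_
  split_ifs with h
  · rfl
  · have := Finset.ne_of_mem_erase hj
    rw [gramC_low g l j (by omega), zero_smul]

theorem gramW_ne {m : ℕ} (g : Matrix (Fin m) (Fin m) ℝ) (hg : IsUnit g) (k : Fin m) :
    gramW g k ≠ 0 := by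
  intro h
  have e : g = (Matrix.of fun l j => gramC g (g l) j) * (Matrix.of fun j => gramW g j) := by
    ext l a
    rw [Matrix.mul_apply]
    have := congrFun (row_full g l) a
    simpa [Finset.sum_apply] using this
  have hd := (Matrix.isUnit_iff_isUnit_det g).1 hg
  rw [e, Matrix.det_mul, Matrix.det_eq_zero_of_row_eq_zero (A := Matrix.of fun j => gramW g j) k
    (fun a => congrFun h a), mul_zero] at hd
  exact not_isUnit_zero hd

theorem mul_row {m : ℕ} (u g : Matrix (Fin m) (Fin m) ℝ) (i : Fin m) :
    (u * g) i = ∑ l, u i l • g l := by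
  ext a
  simp [Matrix.mul_apply, Finset.sum_apply]

theorem gramC_mul_row {m : ℕ} (u g : Matrix (Fin m) (Fin m) ℝ) (i j : Fin m) :
    gramC g ((u * g) i) j = ∑ l, u i l * gramC g (g l) j := by
  unfold gramC
  rw [mul_row, sum_dotProduct, Finset.sum_div]
  refine Finset.sum_congr rfl fun l _ => ?_
  rw [smul_dotProduct, smul_eq_mul, mul_div_assoc]

theorem gramW_unip {m : ℕ} (g u : Matrix (Fin m) (Fin m) ℝ)
    (hu_diag : ∀ i : Fin m, u i i = 1)
    (hu_low : ∀ i j : Fin m, j < i → u i j = 0) :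
    ∀ i, gramW (u * g) i = gramW g i := by
  refine down_ind _ ?_
  intro i ih
  have h1 : gramW (u * g) i = (u * g) i -
      ∑ j : Fin m, if i < j then gramC g ((u * g) i) j • gramW g j else 0 := by
    rw [gramW_eq]
    congr 1
    refine Finset.sum_congr rfl fun j _ => ?_
    split_ifs with h
    · simp only [gramC, ih j h]
    · rfl
  have h2 : (∑ j : Fin m, if i < j then gramC g ((u * g) i) j • gramW g j else 0) =
      ∑ l, u i l • ∑ j : Fin m, if i < j then gramC g (g l) j • gramW g j else 0 := by
    simp_rw [Finset.smul_sum]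
    rw [Finset.sum_comm]
    refine Finset.sum_congr rfl fun j _ => ?_
    split_ifs with h
    · rw [gramC_mul_row, Finset.sum_smul]
      simp only [mul_smul]
    · simp
  rw [h1, h2, mul_row, ← Finset.sum_sub_distrib, Finset.sum_eq_single i]
  · rw [hu_diag, one_smul, one_smul, ← gramW_eq]
  · intro l _ hl
    rcases lt_or_gt_of_ne hl with h | h
    · rw [hu_low i l h]; simp
    · rw [← smul_sub]
      conv_lhs => enter [2, 1]; rw [row_full g l]
      rw [sub_eq_zero.2, smul_zero]
      refine Finset.sum_congr rfl fun j _ => ?_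
      split_ifs with hj
      · rfl
      · rw [gramC_low g l j (by omega), zero_smul]
  · simp

/-- for every invertible m×m real matrix g, every u in the group N_m of
upper triangular matrices with unit diagonal, and every 1 ≤ i ≤ m−1,
λ_i(u·g) = u_{i,i+1} + λ_i(g). -/
theorem gramLambda_unipotent (m : ℕ) (hm : 2 ≤ m)
    (g u : Matrix (Fin m) (Fin m) ℝ) (hg : IsUnit g)
    (hu_diag : ∀ i : Fin m, u i i = 1)
    (hu_low : ∀ i j : Fin m, j < i → u i j = 0) :
    ∀ (i : ℕ) (hi : i + 1 < m),
      gramLambda (u * g) i hi = u ⟨i, by omega⟩ ⟨i + 1, hi⟩ + gramLambda g i hi := by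
  intro i hi
  have hne := gramW_ne g hg ⟨i + 1, hi⟩
  have e1 : gramLambda (u * g) i hi = gramC g ((u * g) ⟨i, by omega⟩) ⟨i + 1, hi⟩ := by
    simp only [gramLambda, gramC, gramW_unip g u hu_diag hu_low]
  have e2 : gramLambda g i hi = gramC g (g ⟨i, by omega⟩) ⟨i + 1, hi⟩ := rfl
  have e3 : gramC g (g ⟨i + 1, hi⟩) ⟨i + 1, hi⟩ = 1 := by
    unfold gramC
    rw [row_dot _ _ _ le_rfl, div_self]
    rwa [Ne, dotProduct_self_eq_zero]
  have hd : (⟨i + 1, hi⟩ : Fin m) ≠ ⟨i, by omega⟩ := by simp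
  rw [e1, e2, gramC_mul_row, Finset.sum_eq_add _ _ hd, e3, hu_diag, mul_one, one_mul]
  · intro l _ hl
    have h1 : (l : ℕ) ≠ i + 1 := fun h => hl.1 (Fin.ext h)
    have h2 : (l : ℕ) ≠ i := fun h => hl.2 (Fin.ext h)
    by_cases h : (l : ℕ) < i
    · rw [hu_low _ l (by simpa [Fin.lt_def] using h), zero_mul]
    · rw [gramC_low g l _ (by rw [Fin.lt_def]; simp only; omega), mul_zero]
  · simp
  · simp
end

section
/- Let g be an invertible (n−1)×(n−1) matrix over F, Z′ an arbitrary (n−1)×(n−1) matrix over F, and Y ∈ F^{n−1} a row vector. Let Z be the n×n matrix with block rows [Z′, 0], [Y, 0] (block column sizes n−1, 1). Then σ·[[1_n, Z],[0, 1_n]]·diag(g, 1, g, 1)·σ^{−1} = [[σ′·C·σ′^{−1}, 0],[0, 1]], where [[1_n, Z],[0,1_n]] is the 2n×2n block matrix with n×n blocks, diag(g,1,g,1) is the 2n×2n block-diagonal matrix with diagonal blocks g, 1, g, 1 (sizes n−1, 1, n−1, 1), and C is the (2n−1)×(2n−1) block matrix with block rows [g, 0, Z′·g], [0, 1, Y·g],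 [0, 0, g]. -/
/-- The 2n×2n permutation matrix σ characterized by σ·e_a = e_{ρ(a)}. -/
def sigmaB (F : Type*) [Zero F] [One F] (n : ℕ) :
    Matrix (Fin (2 * n)) (Fin (2 * n)) F :=
  Matrix.of fun i j => if (i : ℕ) = rhoVal n (j : ℕ) then 1 else 0

/-- The n×n matrix with block rows [Z′, 0], [Y, 0] (block column sizes n−1, 1). -/
def zBlock (F : Type*) [Zero F] (n : ℕ)
    (Z' : Matrix (Fin (n - 1)) (Fin (n - 1)) F) (Y : Fin (n - 1) → F) :
    Matrix (Fin n) (Fin n) F :=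
  Matrix.of fun i j =>
    if hj : (j : ℕ) < n - 1 then
      if hi : (i : ℕ) < n - 1 then Z' ⟨i, hi⟩ ⟨j, hj⟩ else Y ⟨j, hj⟩
    else 0

/-- The 2n×2n block matrix [[1_n, Z],[0, 1_n]] with n×n blocks. -/
def uBlock (F : Type*) [Zero F] [One F] (n : ℕ) (Z : Matrix (Fin n) (Fin n) F) :
    Matrix (Fin (2 * n)) (Fin (2 * n)) F :=
  Matrix.of fun i j =>
    if hi : (i : ℕ) < n then
      if hj : (j : ℕ) < n then (if (i : ℕ) = (j : ℕ) then 1 else 0)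
      else Z ⟨i, hi⟩ ⟨(j : ℕ) - n, by have := j.isLt; omega⟩
    else if (i : ℕ) = (j : ℕ) then 1 else 0

/-- The 2n×2n block-diagonal matrix diag(g, 1, g, 1) with diagonal blocks of sizes
n−1, 1, n−1, 1. -/
def dBlock (F : Type*) [Zero F] [One F] (n : ℕ)
    (g : Matrix (Fin (n - 1)) (Fin (n - 1)) F) :
    Matrix (Fin (2 * n)) (Fin (2 * n)) F :=
  Matrix.of fun i j =>
    if hi : (i : ℕ) < n - 1 then
      (if hj : (j : ℕ) < n - 1 then g ⟨i, hi⟩ ⟨j, hj⟩ else 0)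
    else if hieq : (i : ℕ) = n - 1 then
      (if (j : ℕ) = n - 1 then 1 else 0)
    else if hi2 : (i : ℕ) < 2 * n - 1 then
      (if hj : n ≤ (j : ℕ) ∧ (j : ℕ) < 2 * n - 1 then
        g ⟨(i : ℕ) - n, by omega⟩ ⟨(j : ℕ) - n, by omega⟩
      else 0)
    else if (i : ℕ) = (j : ℕ) then 1 else 0

/-- The (2n−1)×(2n−1) block matrix C with block rows [g, 0, Z′·g], [0, 1, Y·g],
[0, 0, g] (block sizes n−1, 1, n−1). -/
def cBlock (F : Type*) [Semiring F] (n : ℕ)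
    (g Z' : Matrix (Fin (n - 1)) (Fin (n - 1)) F) (Y : Fin (n - 1) → F) :
    Matrix (Fin (2 * n - 1)) (Fin (2 * n - 1)) F :=
  Matrix.of fun i j =>
    if hi : (i : ℕ) < n - 1 then
      if hj : (j : ℕ) < n - 1 then g ⟨i, hi⟩ ⟨j, hj⟩
      else if hj2 : n ≤ (j : ℕ) then
        (Z' * g) ⟨i, hi⟩ ⟨(j : ℕ) - n, by have := j.isLt; omega⟩
      else 0
    else if hieq : (i : ℕ) = n - 1 then
      if (j : ℕ) = n - 1 then 1
      else if hj2 : n ≤ (j : ℕ) then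
        Matrix.vecMul Y g ⟨(j : ℕ) - n, by have := j.isLt; omega⟩
      else 0
    else
      if hj2 : n ≤ (j : ℕ) then
        g ⟨(i : ℕ) - n, by have := i.isLt; omega⟩ ⟨(j : ℕ) - n, by have := j.isLt; omega⟩
      else 0

/-- The 2n×2n block matrix [[Cm, 0],[0, 1]] with Cm of size (2n−1)×(2n−1). -/
def eBlock (F : Type*) [Zero F] [One F] (n : ℕ)
    (Cm : Matrix (Fin (2 * n - 1)) (Fin (2 * n - 1)) F) :
    Matrix (Fin (2 * n)) (Fin (2 * n)) F :=
  Matrix.of fun i j =>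
    if hi : (i : ℕ) < 2 * n - 1 then
      (if hj : (j : ℕ) < 2 * n - 1 then Cm ⟨i, hi⟩ ⟨j, hj⟩ else 0)
    else if hj : (j : ℕ) < 2 * n - 1 then 0 else 1

theorem aux_sum_last {F : Type*} [AddCommMonoid F] (N M : ℕ) (h : N = M + 1) (f : Fin N → F) :
    ∑ k, f k = (∑ k : Fin M, f ⟨k, by omega⟩) + f ⟨M, by omega⟩ := by
  subst h
  rw [Fin.sum_univ_castSucc]
  rfl

theorem aux_sum_add {F : Type*} [AddCommMonoid F] (N M K : ℕ) (h : N = M + K) (f : Fin N → F) :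
    ∑ k, f k = (∑ k : Fin M, f ⟨k, by omega⟩) + ∑ k : Fin K, f ⟨M + k, by omega⟩ := by
  subst h
  rw [Fin.sum_univ_add]
  rfl

theorem aux_eBlock_mul {F : Type*} [Field F] (n : ℕ) (hn : 2 ≤ n)
    (A B : Matrix (Fin (2 * n - 1)) (Fin (2 * n - 1)) F) :
    eBlock F n (A * B) = eBlock F n A * eBlock F n B := by
  ext i j
  rw [Matrix.mul_apply, aux_sum_last (2 * n) (2 * n - 1) (by omega)]
  by_cases hi : (i : ℕ) < 2 * n - 1 <;> by_cases hj : (j : ℕ) < 2 * n - 1 <;>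
    simp [eBlock, hi, hj, Matrix.mul_apply]

theorem aux_eBlock_one {F : Type*} [Field F] (n : ℕ) :
    eBlock F n (1 : Matrix (Fin (2 * n - 1)) (Fin (2 * n - 1)) F) = 1 := by
  ext i j
  have := i.isLt
  have := j.isLt
  simp only [eBlock, Matrix.of_apply, Matrix.one_apply, Fin.ext_iff]
  split_ifs <;> first | rfl | omega

theorem aux_sigma {F : Type*} [Field F] (n : ℕ) :
    sigmaB F n = eBlock F n (sigmaP F n) := by
  ext i j
  have := i.isLt
  have := j.isLt
  simp only [eBlock, sigmaB, sigmaP, Matrix.of_apply, rhoVal]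
  split_ifs <;> first | rfl | omega

theorem aux_sigmaP_inv {F : Type*} [Field F] (n : ℕ) :
    sigmaP F n * (sigmaP F n)⁻¹ = 1 := by
  have h : (sigmaP F n).transpose * sigmaP F n = 1 := by
    ext i j
    have hi := i.isLt
    have hj := j.isLt
    have hr : rhoVal n i < 2 * n - 1 := by unfold rhoVal; split_ifs <;> omega
    rw [Matrix.mul_apply, Finset.sum_eq_single ⟨rhoVal n i, hr⟩]
    · simp only [sigmaP, Matrix.transpose_apply, Matrix.of_apply, Matrix.one_apply, Fin.ext_iff,
        rhoVal]
      split_ifs <;> first | omega | simp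
    · intro b _ hb
      have : (b : ℕ) ≠ rhoVal n i := fun h => hb (Fin.ext h)
      simp [sigmaP, this]
    · simp
  exact Matrix.mul_nonsing_inv _ ((Matrix.isUnit_iff_isUnit_det _).1 (IsUnit.of_mul_eq_one_right _ h))

theorem aux_ud {F : Type*} [Field F] (n : ℕ) (hn : 2 ≤ n)
    (g Z' : Matrix (Fin (n - 1)) (Fin (n - 1)) F) (Y : Fin (n - 1) → F) :
    uBlock F n (zBlock F n Z' Y) * dBlock F n g = eBlock F n (cBlock F n g Z' Y) := by
  obtain ⟨W, hW⟩ : ∃ W : Matrix (Fin (2 * n)) (Fin (2 * n)) F,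
      W = uBlock F n (zBlock F n Z' Y) - 1 := ⟨_, rfl⟩
  have hu : uBlock F n (zBlock F n Z' Y) = 1 + W := by rw [hW]; abel
  have hW1 : ∀ i k : Fin (2 * n), ((k : ℕ) < n ∨ n ≤ (i : ℕ)) → W i k = 0 := by
    intro i k h
    rw [hW, Matrix.sub_apply]
    simp only [uBlock, Matrix.of_apply, Matrix.one_apply, Fin.ext_iff]
    split_ifs <;> first | omega | simp
  have hW2 : ∀ (i : Fin (2 * n)) (hi : (i : ℕ) < n) (k : Fin (2 * n)) (hk : n ≤ (k : ℕ)),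
      W i k = zBlock F n Z' Y ⟨i, hi⟩ ⟨(k : ℕ) - n, by omega⟩ := by
    intro i hi k h
    rw [hW, Matrix.sub_apply]
    simp only [uBlock, Matrix.of_apply, Matrix.one_apply, Fin.ext_iff]
    split_ifs <;> first | omega | simp
  rw [hu, add_mul, one_mul]
  ext i j
  have hi := i.isLt
  have hj := j.isLt
  rw [Matrix.add_apply, Matrix.mul_apply]
  by_cases hin : (i : ℕ) < n
  · have hs : ∑ k, W i k * dBlock F n g k j = ∑ k : Fin (n - 1),
        zBlock F n Z' Y ⟨i, hin⟩ ⟨k, by omega⟩ * dBlock F n g ⟨n + k, by omega⟩ j := by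
      rw [aux_sum_add (2 * n) n n (by omega), Finset.sum_eq_zero, zero_add,
        aux_sum_last n (n - 1) (by omega)]
      · rw [hW2 i hin ⟨n + (n - 1), by omega⟩ (by simp)]
        have hz : zBlock F n Z' Y ⟨i, hin⟩ ⟨n + (n - 1) - n, by omega⟩ = 0 := by
          simp [zBlock]
        rw [hz, zero_mul, add_zero]
        refine Finset.sum_congr rfl fun k _ => ?_
        rw [hW2 i hin _ (by simp)]
        simp
      · intro k _
        rw [hW1 _ _ (Or.inl k.isLt), zero_mul]
    rw [hs]
    have hd : ∀ k : Fin (n - 1), dBlock F n g ⟨n + k, by omega⟩ j =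
        if hj : n ≤ (j : ℕ) ∧ (j : ℕ) < 2 * n - 1 then g k ⟨(j : ℕ) - n, by omega⟩ else 0 := by
      intro k
      have := k.isLt
      simp only [dBlock, Matrix.of_apply]
      split_ifs <;> first | omega | simp
    simp only [hd]
    simp only [eBlock, cBlock, dBlock, zBlock, Matrix.of_apply, Matrix.mul_apply, Matrix.vecMul,
      dotProduct]
    split_ifs <;> first | omega | simp
  · rw [Finset.sum_eq_zero (fun k _ => by rw [hW1 _ _ (Or.inr (by omega)), zero_mul]), add_zero]
    simp only [eBlock, cBlock, dBlock, Matrix.of_apply]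
    split_ifs <;> first | omega | rfl

/-- for g invertible of size (n−1)×(n−1), Z′ arbitrary of size
(n−1)×(n−1), and Y ∈ F^{n−1}, with Z the n×n matrix with block rows [Z′,0],[Y,0]:
σ·[[1_n, Z],[0, 1_n]]·diag(g,1,g,1)·σ^{−1} = [[σ′·C·σ′^{−1}, 0],[0, 1]], where C is
the block matrix with block rows [g, 0, Z′·g], [0, 1, Y·g], [0, 0, g]. -/
theorem sigma_conj_block_formula (F : Type*) [Field F] (n : ℕ) (hn : 2 ≤ n)
    (g : Matrix (Fin (n - 1)) (Fin (n - 1)) F) (hg : IsUnit g)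
    (Z' : Matrix (Fin (n - 1)) (Fin (n - 1)) F) (Y : Fin (n - 1) → F) :
    sigmaB F n * uBlock F n (zBlock F n Z' Y) * dBlock F n g * (sigmaB F n)⁻¹ =
      eBlock F n (sigmaP F n * cBlock F n g Z' Y * (sigmaP F n)⁻¹) := by
  have h : sigmaB F n * eBlock F n (sigmaP F n)⁻¹ = 1 := by
    rw [aux_sigma, ← aux_eBlock_mul n hn, aux_sigmaP_inv, aux_eBlock_one]
  rw [Matrix.inv_eq_right_inv h, Matrix.mul_assoc (sigmaB F n), aux_ud n hn, aux_sigma,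
    aux_eBlock_mul n hn, aux_eBlock_mul n hn]
end

section
/- Let u_0 be an upper triangular (n−1)×(n−1) matrix over F with all diagonal entries equal to 1, and let T be an upper triangular (n−1)×(n−1) matrix over F. Then the (2n−1)×(2n−1) matrix u = σ′·B·σ′^{−1}, where B is the block matrix with block rows [u_0, 0, T·u_0], [0, 1, 0], [0, 0, u_0], is upper triangular with all diagonal entries equal to 1, and the sum of its superdiagonal entries equals the trace of T: Σ_{i=1}^{2n−2} u_{i,i+1} = Tr(T). -/
/-- The (2n−1)×(2n−1) block matrix with block rows [u₀, 0, T·u₀], [0, 1, 0],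
[0, 0, u₀] with respect to the decomposition of the index set into blocks of sizes
n−1, 1, n−1. -/
def blockUT (F : Type*) [Semiring F] (n : ℕ)
    (u0 T : Matrix (Fin (n - 1)) (Fin (n - 1)) F) :
    Matrix (Fin (2 * n - 1)) (Fin (2 * n - 1)) F :=
  Matrix.of fun i j =>
    if hi : (i : ℕ) < n - 1 then
      if hj : (j : ℕ) < n - 1 then u0 ⟨i, hi⟩ ⟨j, hj⟩
      else if hj2 : n ≤ (j : ℕ) then
        (T * u0) ⟨i, hi⟩ ⟨(j : ℕ) - n, by have := j.isLt; omega⟩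
      else 0
    else if (i : ℕ) = n - 1 then
      if (j : ℕ) = n - 1 then 1 else 0
    else
      if hi2 : n ≤ (i : ℕ) then
        if hj2 : n ≤ (j : ℕ) then
          u0 ⟨(i : ℕ) - n, by have := i.isLt; omega⟩ ⟨(j : ℕ) - n, by have := j.isLt; omega⟩
        else 0
      else 0

/-- The inverse of rho on 0-based indices. -/
def tauIdx (n : ℕ) (i : Fin (2 * n - 1)) : Fin (2 * n - 1) :=
  ⟨if (i : ℕ) % 2 = 0 then (i : ℕ) / 2 else n + (i : ℕ) / 2, by
    have := i.isLt
    split_ifs <;> omega⟩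

theorem tauIdx_val (n : ℕ) (i : Fin (2 * n - 1)) :
    ((i : ℕ) % 2 = 0 ∧ (tauIdx n i : ℕ) = (i : ℕ) / 2) ∨
      ((i : ℕ) % 2 = 1 ∧ (tauIdx n i : ℕ) = n + (i : ℕ) / 2) := by
  simp only [tauIdx]
  split_ifs <;> omega

theorem tauIdx_inj (n : ℕ) (i j : Fin (2 * n - 1)) : tauIdx n i = tauIdx n j ↔ i = j := by
  have := i.isLt
  have := j.isLt
  simp only [tauIdx, Fin.ext_iff]
  split_ifs <;> omega

theorem sigmaP_apply_tau (F : Type*) [Zero F] [One F] (n : ℕ) (i j : Fin (2 * n - 1)) :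
    sigmaP F n i j = if tauIdx n i = j then 1 else 0 := by
  have h : ((i : ℕ) = rhoVal n (j : ℕ)) ↔ tauIdx n i = j := by
    have := i.isLt
    have := j.isLt
    simp only [tauIdx, Fin.ext_iff, rhoVal]
    split_ifs <;> omega
  simp only [sigmaP, Matrix.of_apply, h]

theorem sigmaP_inv (F : Type*) [Field F] (n : ℕ) :
    (sigmaP F n)⁻¹ = (sigmaP F n).transpose := by
  apply Matrix.inv_eq_right_inv
  ext i j
  simp [Matrix.mul_apply, sigmaP_apply_tau, Matrix.one_apply, tauIdx_inj, eq_comm]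

theorem conj_apply (F : Type*) [Field F] (n : ℕ)
    (B : Matrix (Fin (2 * n - 1)) (Fin (2 * n - 1)) F) (i j : Fin (2 * n - 1)) :
    (sigmaP F n * B * (sigmaP F n)⁻¹) i j = B (tauIdx n i) (tauIdx n j) := by
  rw [sigmaP_inv]
  simp [Matrix.mul_apply, sigmaP_apply_tau]

/-- if u₀ is upper triangular with unit diagonal and T is upper
triangular (both (n−1)×(n−1) over a field F), then u = σ′·B·σ′^{−1}, with B the
block matrix with block rows [u₀, 0, T·u₀], [0, 1, 0], [0, 0, u₀], is upper
triangular with all diagonal entries 1, and the sum of its superdiagonal entries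
equals the trace of T. -/
theorem sigma_conj_unipotent_superdiag (F : Type*) [Field F] (n : ℕ) (hn : 2 ≤ n)
    (u0 T : Matrix (Fin (n - 1)) (Fin (n - 1)) F)
    (hu0diag : ∀ i : Fin (n - 1), u0 i i = 1)
    (hu0low : ∀ i j : Fin (n - 1), j < i → u0 i j = 0)
    (hT : ∀ i j : Fin (n - 1), j < i → T i j = 0) :
    ((∀ i : Fin (2 * n - 1),
        (sigmaP F n * blockUT F n u0 T * (sigmaP F n)⁻¹) i i = 1) ∧
      (∀ i j : Fin (2 * n - 1), j < i →
        (sigmaP F n * blockUT F n u0 T * (sigmaP F n)⁻¹) i j = 0)) ∧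
    ∑ i : Fin (2 * n - 2),
        (sigmaP F n * blockUT F n u0 T * (sigmaP F n)⁻¹)
          ⟨(i : ℕ), by have := i.isLt; omega⟩
          ⟨(i : ℕ) + 1, by have := i.isLt; omega⟩ =
      Matrix.trace T := by
  have hTu : ∀ i j : Fin (n - 1), j < i → (T * u0) i j = 0 := by
    intro i j hij
    rw [Matrix.mul_apply]
    refine Finset.sum_eq_zero fun k _ => ?_
    rcases lt_or_ge k i with h | h
    · rw [hT i k h, zero_mul]
    · rw [hu0low k j (lt_of_lt_of_le hij h), mul_zero]
  have hTd : ∀ i : Fin (n - 1), (T * u0) i i = T i i := by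
    intro i
    rw [Matrix.mul_apply, Finset.sum_eq_single i]
    · rw [hu0diag, mul_one]
    · intro k _ hk
      rcases lt_or_gt_of_ne hk with h | h
      · rw [hT i k h, zero_mul]
      · rw [hu0low k i h, mul_zero]
    · simp
  simp only [conj_apply]
  refine ⟨⟨?_, ?_⟩, ?_⟩
  · intro i
    have := i.isLt
    simp only [blockUT, Matrix.of_apply]
    split_ifs <;> first | apply hu0diag | rfl | omega
  · intro i j hij
    have := i.isLt
    have := j.isLt
    rw [Fin.lt_def] at hij
    simp only [blockUT, Matrix.of_apply]
    have hi := tauIdx_val n i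
    have hj := tauIdx_val n j
    split_ifs <;> first
      | rfl
      | (exfalso; omega)
      | (refine hu0low _ _ (Fin.lt_def.mpr ?_); simp only; omega)
      | (refine hTu _ _ (Fin.lt_def.mpr ?_); simp only; omega)
  · symm
    rw [Matrix.trace]
    refine Fintype.sum_of_injective
      (fun a : Fin (n - 1) => (⟨2 * (a : ℕ), by have := a.isLt; omega⟩ : Fin (2 * n - 2)))
      ?_ _ _ ?_ ?_
    · intro a b h
      simp only [Fin.mk.injEq] at h
      exact Fin.ext (by omega)
    · intro i hi
      have hlt := i.isLt
      have hodd : (i : ℕ) % 2 = 1 := by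
        by_contra hne
        exact hi ⟨⟨(i : ℕ) / 2, by omega⟩, Fin.ext (by simp only; omega)⟩
      have e1 : ((tauIdx n ⟨(i : ℕ), by omega⟩ : Fin (2 * n - 1)) : ℕ) = n + (i : ℕ) / 2 := by
        simp only [tauIdx]; rw [if_neg (by omega)]
      have e2 : ((tauIdx n ⟨(i : ℕ) + 1, by omega⟩ : Fin (2 * n - 1)) : ℕ)
          = ((i : ℕ) + 1) / 2 := by
        simp only [tauIdx]; rw [if_pos (by omega)]
      simp only [blockUT, Matrix.of_apply]
      rw [dif_neg (by omega), if_neg (by omega), dif_pos (by omega), dif_neg (by omega)]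
    · intro a
      have ha := a.isLt
      have e1 : ((tauIdx n ⟨2 * (a : ℕ), by omega⟩ : Fin (2 * n - 1)) : ℕ) = a := by
        simp only [tauIdx]; rw [if_pos (by omega)]; omega
      have e2 : ((tauIdx n ⟨2 * (a : ℕ) + 1, by omega⟩ : Fin (2 * n - 1)) : ℕ) = n + a := by
        simp only [tauIdx]; rw [if_neg (by omega)]; omega
      simp only [blockUT, Matrix.of_apply]
      rw [dif_pos (by omega), dif_neg (by omega), dif_pos (by omega), Matrix.diag_apply, ← hTd]
      exact congrArg₂ (T * u0) (Fin.ext (by simp only; omega)) (Fin.ext (by simp only; omega))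
end
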